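/- arXiv:1212.2522 — 9 statements merged into one kernel-verified Lean document; each statement's English description precedes it below -/
import Mathlib

section
/- Let Y be a linear subspace of a real Banach space X and x* ∈ X*. Write Z for the linear subspace {x ∈ X : ⟨x, x*⟩ = 0} of X. Then the polar subspace (Y ∩ Z)⁰ equals the linear span of {x*} ∪ Y⁰, i.e. (Y ∩ Z)⁰ = lin{x*, Y⁰}. -/
open NormedSpace

/-- Let `Y` be a linear subspace of a real Banach space `X` and `x' ∈ X*`.
With `Z := {x ∈ X : ⟨x, x'⟩ = 0}` (here `LinearMap.ker x'`), the polar subspace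
`(Y ∩ Z)⁰ = {f ∈ X* : f = 0 on Y ∩ Z}` equals the linear span of `{x'} ∪ Y⁰`. -/
theorem polar_inter_ker_eq_span {X : Type*} [NormedAddCommGroup X] [NormedSpace ℝ X]
    [CompleteSpace X] (Y : Submodule ℝ X) (x' : StrongDual ℝ X) :
    {f : StrongDual ℝ X | ∀ x ∈ Y ⊓ LinearMap.ker (x' : X →ₗ[ℝ] ℝ), f x = 0} =
      ↑(Submodule.span ℝ (insert x' {f : StrongDual ℝ X | ∀ y ∈ Y, f y = 0})) := by
  ext f
  simp only [Set.mem_ofPred_eq, SetLike.mem_coe]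
  constructor
  · intro hf
    by_cases h : ∃ y ∈ Y, x' y ≠ 0
    · obtain ⟨y, hy, hy0⟩ := h
      have hmem : f - (f y / x' y) • x' ∈ {f : StrongDual ℝ X | ∀ y ∈ Y, f y = 0} := by
        intro z hz
        have key := hf (z - (x' z / x' y) • y)
          ⟨Y.sub_mem hz (Y.smul_mem _ hy), by simp [hy0]⟩
        simp only [map_sub, map_smul, smul_eq_mul] at key
        simp only [sub_apply, smul_apply, smul_eq_mul]
        linear_combination key
      rw [← sub_add_cancel f ((f y / x' y) • x')]
      exact add_mem (Submodule.subset_span (Set.mem_insert_of_mem _ hmem))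
        (Submodule.smul_mem _ _ (Submodule.subset_span (Set.mem_insert _ _)))
    · push Not at h
      exact Submodule.subset_span (Set.mem_insert_of_mem _ fun y hy => hf y ⟨hy, h y hy⟩)
  · rintro hf x ⟨hxY, hxK⟩
    induction hf using Submodule.span_induction with
    | mem g hg =>
      rcases hg with rfl | hg
      · exact hxK
      · exact hg x hxY
    | zero => rfl
    | add g h _ _ hg hh => simp [hg, hh]
    | smul c g _ hg => simp [hg]
end

section
/- Let (B, L) be a Banach SN space, A be a linear subspace of B, b ∈ B, and suppose that {b} ∪ A is L-positive. Then the linear subspace lin{b, A} of B (the linear span of {b} ∪ A) is L-positive. -/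
open NormedSpace

variable {B : Type*} [NormedAddCommGroup B] [NormedSpace ℝ B]

/-- `L : B → B*` is an SN ("symmetric nonexpansive") map: `‖L‖ ≤ 1` and
`⟨b, Lc⟩ = ⟨c, Lb⟩` for all `b, c ∈ B`. -/
def IsSNMap (L : B →L[ℝ] StrongDual ℝ B) : Prop :=
  ‖L‖ ≤ 1 ∧ ∀ b c : B, L c b = L b c

/-- The quadratic form `q_L(b) := (1/2)⟨b, Lb⟩` of an SN map. -/
noncomputable def qL (L : B →L[ℝ] StrongDual ℝ B) (b : B) : ℝ :=
  (1 / 2) * L b b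

/-- `A ⊆ B` is `L`-positive: `A ≠ ∅` and `q_L(b - c) ≥ 0` for all `b, c ∈ A`. -/
def LPos (L : B →L[ℝ] StrongDual ℝ B) (A : Set B) : Prop :=
  A.Nonempty ∧ ∀ b ∈ A, ∀ c ∈ A, 0 ≤ qL L (b - c)

/-- `A` is maximally `L`-positive: it is `L`-positive and not properly contained in
any other `L`-positive subset of `B`. -/
def MaxLPos (L : B →L[ℝ] StrongDual ℝ B) (A : Set B) : Prop :=
  LPos L A ∧ ∀ C : Set B, LPos L C → A ⊆ C → C = A

/-- The polar subspace `A⁰ := {b* ∈ B* : ⟨a, b*⟩ = 0 for all a ∈ A}`. -/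
def polarSet (A : Set B) : Set (StrongDual ℝ B) :=
  {f | ∀ a ∈ A, f a = 0}

/-- `(B*, L')` is a Banach SN dual of `(B, L)`: `L'` is an SN map on `B*` and
`⟨Lb, L'b*⟩ = ⟨b, b*⟩` for all `b ∈ B`, `b* ∈ B*`. -/
def IsSNDual (L : B →L[ℝ] StrongDual ℝ B) (L' : StrongDual ℝ B →L[ℝ] StrongDual ℝ (StrongDual ℝ B)) : Prop :=
  IsSNMap L' ∧ ∀ (b : B) (b' : StrongDual ℝ B), L' b' (L b) = b' b

/-- `q_L` is homogeneous of degree two. -/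
theorem qL_smul (L : B →L[ℝ] StrongDual ℝ B) (t : ℝ) (b : B) :
    qL L (t • b) = t ^ 2 * qL L b := by
  simp only [qL, map_smul, smul_apply, smul_eq_mul]
  ring

/-- If `A` is a linear subspace of a Banach SN space `(B, L)`, `b ∈ B`, and
`{b} ∪ A` is `L`-positive, then the linear span of `{b} ∪ A` is `L`-positive. -/
theorem span_LPos_of_insert_LPos [CompleteSpace B] [Nontrivial B]
    (L : B →L[ℝ] StrongDual ℝ B) (hL : IsSNMap L) (A : Submodule ℝ B) (b : B)
    (h : LPos L (insert b (A : Set B))) :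
    LPos L ((Submodule.span ℝ (insert b (A : Set B)) : Submodule ℝ B) : Set B) := by
  refine ⟨⟨0, Submodule.zero_mem _⟩, fun x hx y hy => ?_⟩
  have hxy := Submodule.sub_mem _ hx hy
  rw [Submodule.mem_span_insert, Submodule.span_eq] at hxy
  obtain ⟨t, a, ha, hta⟩ := hxy
  rw [hta]
  rcases eq_or_ne t 0 with rfl | ht
  · simpa using h.2 a (Or.inr ha) 0 (Or.inr A.zero_mem)
  · have hsub : t • b + a = t • (b - -(t⁻¹ • a)) := by
      rw [sub_neg_eq_add, smul_add, smul_inv_smul₀ ht]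
    rw [hsub, qL_smul]
    exact mul_nonneg (sq_nonneg t)
      (h.2 b (Or.inl rfl) _ (Or.inr (A.neg_mem (A.smul_mem _ ha))))
end

section
/- Let (B, L) be a Banach SN space with Banach SN dual (B*, L̃), suppose L(B) = B* (L is surjective onto B*), and let A be a maximally L-positive subset of B. Then for every c* ∈ B*, inf_{a ∈ A} q_{L̃}(La − c*) ≤ 0. -/
open NormedSpace

variable {B : Type*} [NormedAddCommGroup B] [NormedSpace ℝ B]

/-- Let `(B, L)` be a Banach SN space with Banach SN dual `(B*, L')`,
`L` surjective onto `B*`, and `A` maximally `L`-positive.  Then for every `c* ∈ B*`,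
`inf_{a ∈ A} q_{L'}(La - c*) ≤ 0`. -/
theorem inf_qDual_nonpos_of_maxLPos_of_surjective [CompleteSpace B] [Nontrivial B]
    (L : B →L[ℝ] StrongDual ℝ B) (L' : StrongDual ℝ B →L[ℝ] StrongDual ℝ (StrongDual ℝ B))
    (hL : IsSNMap L) (hdual : IsSNDual L L') (hsurj : Function.Surjective (⇑L))
    (A : Set B) (hA : MaxLPos L A) (c' : StrongDual ℝ B) :
    sInf ((fun a => qL L' (L a - c')) '' A) ≤ 0 := by
  obtain ⟨c, rfl⟩ := hsurj c'
  have hq : ∀ a, qL L' (L a - L c) = qL L (a - c) := fun a => by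
    simp only [qL, ← map_sub L, hdual.2]
  have hneg : ∀ b, qL L (-b) = qL L b := fun b => by simp [qL]
  obtain ⟨a, ha, hac⟩ : ∃ a ∈ A, qL L (a - c) ≤ 0 := by
    by_contra! h
    have hpos : LPos L (insert c A) := by
      refine ⟨Set.insert_nonempty c A, ?_⟩
      rintro x (rfl | hx) y (rfl | hy)
      · simp [qL]
      · rw [← neg_sub, hneg]
        exact (h y hy).le
      · exact (h x hx).le
      · exact hA.1.2 x hx y hy
    have hc : c ∈ A := hA.2 _ hpos (Set.subset_insert c A) ▸ Set.mem_insert c A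
    simpa [qL] using h c hc
  by_cases hbdd : BddBelow ((fun a => qL L' (L a - L c)) '' A)
  · exact csInf_le_of_le hbdd ⟨a, ha, rfl⟩ ((hq a).trans_le hac)
  · exact (Real.sInf_of_not_bddBelow hbdd).le
end

section
/- Let (B, L) be a Banach SN space, A be a closed linear L-positive subspace of B, and d ∈ B. Define q_L^{A,d} : B → (−∞, ∞] by q_L^{A,d}(b) := q_L(b) if b ∈ A − d and q_L^{A,d}(b) := ∞ otherwise. Then q_L^{A,d} is proper and convex, and for every b ∈ B its subdifferential satisfies: ∂q_L^{A,d}(b) = Lb + A⁰ if b ∈ A − d, and ∂q_L^{A,d}(b) = ∅ otherwise. -/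
open NormedSpace

variable {B : Type*} [NormedAddCommGroup B] [NormedSpace ℝ B]

/-- Expansion of the quadratic form `q_L` along a line. -/
theorem qL_add_smul {L : B →L[ℝ] StrongDual ℝ B} (hL : IsSNMap L) (b a : B) (s : ℝ) :
    qL L (b + s • a) = qL L b + s * L b a + s ^ 2 * qL L a := by
  have h := hL.2 b a
  simp only [qL, map_add, map_smul, add_apply, smul_apply, smul_eq_mul, h]
  ring

theorem LPos.qL_nonneg {L : B →L[ℝ] StrongDual ℝ B} {A : Submodule ℝ B}
    (hA : LPos L (A : Set B)) {a : B} (ha : a ∈ A) : 0 ≤ qL L a := by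
  simpa using hA.2 a ha 0 A.zero_mem

theorem qL_convex_combination_le {L : B →L[ℝ] StrongDual ℝ B} (hL : IsSNMap L) {x y : B}
    (hxy : 0 ≤ qL L (x - y)) {t : ℝ} (ht₀ : 0 ≤ t) (ht₁ : t ≤ 1) :
    qL L (t • x + (1 - t) • y) ≤ t * qL L x + (1 - t) * qL L y := by
  have h₁ := qL_add_smul hL y (x - y) t
  have h₂ := qL_add_smul hL y (x - y) 1
  rw [show y + t • (x - y) = t • x + (1 - t) • y by module] at h₁
  rw [show y + (1 : ℝ) • (x - y) = x by module] at h₂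
  rw [h₁, h₂]
  nlinarith [mul_nonneg (mul_nonneg ht₀ (sub_nonneg.2 ht₁)) hxy]

/-- A linear term dominated by a nonnegative quadratic term vanishes. -/
theorem eq_zero_of_forall_mul_le_sq_mul {g q : ℝ} (hq : 0 ≤ q)
    (h : ∀ s : ℝ, s * g ≤ s ^ 2 * q) : g = 0 := by
  have hs := h (g / (q + 1))
  have hq₁ : 0 < q + 1 := by linarith
  rw [div_pow, div_mul_eq_mul_div, div_mul_eq_mul_div,
    div_le_div_iff₀ hq₁ (by positivity)] at hs
  have : g ^ 2 * (q + 1) ≤ 0 := by nlinarith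
  have : g ^ 2 ≤ 0 := nonpos_of_mul_nonpos_left this hq₁
  exact pow_eq_zero_iff two_ne_zero |>.1 (le_antisymm this (sq_nonneg g))

/-- Let `A` be a closed linear `L`-positive subspace of `B` and `d ∈ B`.
The function `q_L^{A,d}` (equal to `q_L` on `A - d` and `∞` elsewhere, taking values in
`(-∞, ∞]`, modelled by `EReal`) is proper and convex, and its subdifferential at `b` is
`Lb + A⁰` when `b ∈ A - d` and `∅` otherwise. -/
theorem qLAd_proper_convex_subdifferential [CompleteSpace B] [Nontrivial B]
    (L : B →L[ℝ] StrongDual ℝ B) (hL : IsSNMap L)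
    (A : Submodule ℝ B) (hAc : IsClosed (A : Set B)) (hApos : LPos L (A : Set B)) (d : B)
    (f : B → EReal)
    (hf₁ : ∀ b : B, b + d ∈ A → f b = (qL L b : EReal))
    (hf₂ : ∀ b : B, b + d ∉ A → f b = ⊤) :
    (∃ (b : B) (r : ℝ), f b = (r : EReal)) ∧
    (∀ x y : B, ∀ t : ℝ, 0 ≤ t → t ≤ 1 →
      f (t • x + (1 - t) • y) ≤ (t : EReal) * f x + ((1 - t : ℝ) : EReal) * f y) ∧
    (∀ b : B,
      (b + d ∈ A →
        {b' : StrongDual ℝ B | ∀ c : B, f b + ((b' (c - b) : ℝ) : EReal) ≤ f c} =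
          {b' : StrongDual ℝ B | ∃ g ∈ polarSet (A : Set B), b' = L b + g}) ∧
      (b + d ∉ A →
        {b' : StrongDual ℝ B | ∀ c : B, f b + ((b' (c - b) : ℝ) : EReal) ≤ f c} = ∅)) := by
  refine ⟨⟨-d, qL L (-d), hf₁ _ (by simp)⟩, fun x y t ht₀ ht₁ => ?_,
    fun b => ⟨fun hb => ?_, fun hb => ?_⟩⟩
  · rcases ht₀.eq_or_lt with rfl | ht₀'
    · simp
    rcases ht₁.eq_or_lt with rfl | ht₁'
    · simp
    have ht₂ : 0 < 1 - t := sub_pos.2 ht₁'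
    have hmul : ∀ {r : ℝ} (z : B), 0 < r → (r : EReal) * f z ≠ ⊥ := fun {r} z hr => by
      by_cases hz : z + d ∈ A
      · rw [hf₁ z hz, ← EReal.coe_mul]
        exact EReal.coe_ne_bot _
      · simp [hf₂ z hz, EReal.coe_mul_top_of_pos hr]
    by_cases hx : x + d ∈ A
    · by_cases hy : y + d ∈ A
      · have hz : t • x + (1 - t) • y + d ∈ A := by
          have := A.add_mem (A.smul_mem t hx) (A.smul_mem (1 - t) hy)
          rwa [show t • (x + d) + (1 - t) • (y + d) = t • x + (1 - t) • y + d by module] at this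
        have hxy : x - y ∈ A := by simpa using A.sub_mem hx hy
        rw [hf₁ _ hz, hf₁ _ hx, hf₁ _ hy]
        exact_mod_cast qL_convex_combination_le hL (hApos.qL_nonneg hxy) ht₀ ht₁
      · rw [hf₂ y hy, EReal.coe_mul_top_of_pos ht₂, EReal.add_top_of_ne_bot (hmul x ht₀')]
        exact le_top
    · rw [hf₂ x hx, EReal.coe_mul_top_of_pos ht₀', EReal.top_add_of_ne_bot (hmul y ht₂)]
      exact le_top
  · ext b'
    simp only [Set.mem_ofPred_eq]
    constructor
    · refine fun h => ⟨b' - L b, fun a ha => ?_, by simp⟩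
      refine eq_zero_of_forall_mul_le_sq_mul (hApos.qL_nonneg ha) fun s => ?_
      have hs := h (b + s • a)
      rw [hf₁ b hb, hf₁ (b + s • a) (by
        rw [add_right_comm]
        exact A.add_mem hb (A.smul_mem s ha)), qL_add_smul hL, ← EReal.coe_add,
        EReal.coe_le_coe_iff] at hs
      simp only [add_sub_cancel_left, map_smul, smul_eq_mul] at hs
      simp only [sub_apply]
      linarith
    · rintro ⟨g, hg, rfl⟩ c
      by_cases hc : c + d ∈ A
      · have hcb : c - b ∈ A := by simpa using A.sub_mem hc hb
        have hq := qL_add_smul hL b (c - b) 1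
        rw [one_smul, add_sub_cancel] at hq
        rw [hf₁ b hb, hf₁ c hc, ← EReal.coe_add, EReal.coe_le_coe_iff, add_apply,
          hg _ hcb, hq]
        linarith [hApos.qL_nonneg hcb]
      · rw [hf₂ c hc]
        exact le_top
  · refine Set.eq_empty_of_forall_notMem fun b' h => ?_
    have hd := h (-d)
    rw [hf₂ b hb, hf₁ (-d) (by simp), EReal.top_add_coe] at hd
    exact EReal.coe_ne_top _ (top_le_iff.1 hd)
end

section
/- Let (B, L) be a Banach SN space with Banach SN dual (B*, L̃), and set Λ := −L̃. Let A be a closed linear L-positive subspace of B such that A⁰ is Λ-positive, let d ∈ B, c* ∈ B*, δ := inf_{a ∈ A} ‖a − d‖, and η > 0. Then there exists b ∈ A − d such that ηδ ≤ q_Λ(Lb − c*) + 3‖c*‖η + 5η². -/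
open NormedSpace

variable {B : Type*} [NormedAddCommGroup B] [NormedSpace ℝ B]

set_option maxSynthPendingDepth 3

/-- A linear functional on a subspace dominated by a convex function extends to a linear functional
on the whole space dominated by the same function. -/
theorem exists_extension_of_le_convexOn {E : Type*} [AddCommGroup E] [Module ℝ E]
    (p : Submodule ℝ E) (f : p →ₗ[ℝ] ℝ) {h : E → ℝ} (hconv : ConvexOn ℝ Set.univ h)
    (hf : ∀ x : p, f x ≤ h x) :
    ∃ g : E →ₗ[ℝ] ℝ, (∀ x : p, g x = f x) ∧ ∀ x, g x ≤ h x := by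
  have h0 : 0 ≤ h 0 := by simpa using hf 0
  have key : ∀ x y : E, ∀ s t : ℝ, 0 < s → 0 < t →
      (t * s / (s + t))⁻¹ * h ((t * s / (s + t)) • (x + y)) ≤
        s⁻¹ * h (s • x) + t⁻¹ * h (t • y) := by
    intro x y s t hs ht
    have hst : 0 < s + t := add_pos hs ht
    have hc := hconv.2 (Set.mem_univ (s • x)) (Set.mem_univ (t • y))
      (show 0 ≤ t / (s + t) by positivity) (show 0 ≤ s / (s + t) by positivity)
      (by field_simp; ring)
    have he : (t / (s + t)) • s • x + (s / (s + t)) • t • y =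
        (t * s / (s + t)) • (x + y) := by
      rw [smul_add, smul_smul, smul_smul]
      congr 2 <;> ring
    rw [he, smul_eq_mul, smul_eq_mul] at hc
    calc (t * s / (s + t))⁻¹ * h ((t * s / (s + t)) • (x + y))
        ≤ (t * s / (s + t))⁻¹ * (t / (s + t) * h (s • x) + s / (s + t) * h (t • y)) := by
          gcongr
      _ = s⁻¹ * h (s • x) + t⁻¹ * h (t • y) := by field_simp
  let P : E → ℝ := fun x => ⨅ t : Set.Ioi (0 : ℝ), (t : ℝ)⁻¹ * h ((t : ℝ) • x)
  have hbdd : ∀ x, BddBelow (Set.range fun t : Set.Ioi (0 : ℝ) => (t : ℝ)⁻¹ * h ((t : ℝ) • x)) := by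
    intro x
    refine ⟨-h (-x), ?_⟩
    rintro _ ⟨⟨t, ht⟩, rfl⟩
    have ht : 0 < t := ht
    have hk := key x (-x) t 1 ht one_pos
    simp only [add_neg_cancel, smul_zero, inv_one, one_mul, one_smul] at hk
    have : 0 ≤ (t / (t + 1))⁻¹ * h 0 := by positivity
    change -h (-x) ≤ t⁻¹ * h (t • x)
    linarith
  have hP_le : ∀ (x : E) (t : ℝ), 0 < t → P x ≤ t⁻¹ * h (t • x) :=
    fun x t ht => ciInf_le (hbdd x) ⟨t, ht⟩
  have hle_P : ∀ (x : E) (c : ℝ), (∀ t : ℝ, 0 < t → c ≤ t⁻¹ * h (t • x)) → c ≤ P x :=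
    fun x c hc => le_ciInf fun t => hc t t.2
  have hhom_le : ∀ c : ℝ, 0 < c → ∀ x, P (c • x) ≤ c * P x := by
    intro c hc x
    rw [← div_le_iff₀' hc]
    refine hle_P x _ fun t ht => ?_
    rw [div_le_iff₀' hc]
    refine (hP_le (c • x) (t / c) (by positivity)).trans_eq ?_
    rw [smul_smul, div_mul_cancel₀ _ hc.ne']
    field_simp
  have hhom : ∀ c : ℝ, 0 < c → ∀ x, P (c • x) = c * P x := by
    intro c hc x
    refine le_antisymm (hhom_le c hc x) ?_
    have := hhom_le c⁻¹ (by positivity) (c • x)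
    rw [smul_smul, inv_mul_cancel₀ hc.ne', one_smul] at this
    calc c * P x ≤ c * (c⁻¹ * P (c • x)) := by gcongr
      _ = P (c • x) := by field_simp
  have hadd : ∀ x y, P (x + y) ≤ P x + P y := by
    intro x y
    rw [← sub_le_iff_le_add]
    refine hle_P x _ fun s hs => ?_
    rw [sub_le_iff_le_add, ← sub_le_iff_le_add']
    refine hle_P y _ fun t ht => ?_
    rw [sub_le_iff_le_add']
    exact (hP_le _ _ (by positivity)).trans (key x y s t hs ht)
  obtain ⟨g, hg, hgP⟩ := exists_extension_of_le_sublinear ⟨p, f⟩ P hhom hadd (by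
    intro x
    refine hle_P x _ fun t ht => ?_
    have := hf (t • x)
    rw [map_smul, smul_eq_mul] at this
    change f x ≤ _
    rw [← div_eq_inv_mul, le_div_iff₀' ht]
    exact this)
  refine ⟨g, hg, fun x => (hgP x).trans ?_⟩
  simpa using hP_le x 1 one_pos

theorem qL_add {L : B →L[ℝ] StrongDual ℝ B} (hL : ∀ b c : B, L c b = L b c) (b c : B) :
    qL L (b + c) = qL L b + L b c + qL L c := by
  simp only [qL, map_add, add_apply]
  rw [hL b c]
  ring

theorem abs_apply_apply_le {L : B →L[ℝ] StrongDual ℝ B} (hL : ‖L‖ ≤ 1) (b c : B) :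
    |L b c| ≤ ‖b‖ * ‖c‖ := by
  have h := L.le_opNorm₂ b c
  rw [Real.norm_eq_abs] at h
  refine h.trans ?_
  gcongr
  exact mul_le_of_le_one_left (norm_nonneg b) hL

theorem qL_le {L : B →L[ℝ] StrongDual ℝ B} (hL : ‖L‖ ≤ 1) (b : B) :
    qL L b ≤ 1 / 2 * ‖b‖ ^ 2 := by
  have := (abs_le.1 (abs_apply_apply_le hL b b)).2
  rw [qL, sq]
  linarith

theorem qL_neg_map (L : B →L[ℝ] StrongDual ℝ B) (b : B) : qL (-L) b = -qL L b := by
  simp [qL]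

theorem qL_neg (L : B →L[ℝ] StrongDual ℝ B) (b : B) : qL L (-b) = qL L b := by
  simp [qL]

theorem IsSNDual.qL_neg_sub {L : B →L[ℝ] StrongDual ℝ B}
    {L' : StrongDual ℝ B →L[ℝ] StrongDual ℝ (StrongDual ℝ B)} (hdual : IsSNDual L L')
    (b : B) (c' : StrongDual ℝ B) :
    qL (-L') (L b - c') = c' b - qL L b - qL L' c' := by
  rw [qL_neg_map, sub_eq_add_neg, qL_add hdual.1.2, qL_neg, map_neg, hdual.1.2 c' (L b), hdual.2]
  simp only [qL, hdual.2]
  ring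

/-- A linear functional dominated by a perturbed increment `x ↦ β (‖b + x‖ - ‖b‖) + ‖x‖² / 2 + s² / 2`
of a multiple of the norm is bounded by `β + s`, and its value at `b` is almost `β * ‖b‖`. -/
theorem bounds_of_le_norm_increment {g : B →ₗ[ℝ] ℝ} {b : B} {β s : ℝ} (hβ : 0 ≤ β) (hs : 0 < s)
    (hg : ∀ x, g x ≤ β * (‖b + x‖ - ‖b‖) + 1 / 2 * ‖x‖ ^ 2 + s ^ 2 / 2) :
    (∀ x, ‖g x‖ ≤ (β + s) * ‖x‖) ∧ (s ≤ ‖b‖ → (β - s) * ‖b‖ ≤ g b) := by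
  have hle : ∀ x, g x ≤ (β + s) * ‖x‖ := by
    intro x
    rcases eq_or_ne x 0 with rfl | hx
    · simp
    have hx : 0 < ‖x‖ := norm_pos_iff.2 hx
    have hn : ‖(s / ‖x‖) • x‖ = s := by
      rw [norm_smul, Real.norm_of_nonneg (by positivity), div_mul_cancel₀ _ hx.ne']
    have h := hg ((s / ‖x‖) • x)
    have ht := norm_add_le b ((s / ‖x‖) • x)
    rw [map_smul, smul_eq_mul, hn] at h
    rw [hn] at ht
    have h' : s / ‖x‖ * g x ≤ s * (β + s) := by
      have : β * (‖b + (s / ‖x‖) • x‖ - ‖b‖) ≤ β * s := by gcongr; linarith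
      linarith
    rw [div_mul_eq_mul_div, div_le_iff₀ hx, mul_assoc] at h'
    exact le_of_mul_le_mul_left h' hs
  refine ⟨fun x => abs_le.2 ⟨?_, hle x⟩, fun hsb => ?_⟩
  · have := hle (-x)
    rw [map_neg, norm_neg] at this
    linarith
  · have hb : 0 < ‖b‖ := hs.trans_le hsb
    have hn : ‖(-(s / ‖b‖)) • b‖ = s := by
      rw [norm_smul, norm_neg, Real.norm_of_nonneg (by positivity), div_mul_cancel₀ _ hb.ne']
    have hn' : ‖b + (-(s / ‖b‖)) • b‖ = ‖b‖ - s := by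
      have : b + (-(s / ‖b‖)) • b = (1 - s / ‖b‖) • b := by module
      rw [this, norm_smul, Real.norm_of_nonneg (sub_nonneg.2 ((div_le_one hb).2 hsb)), sub_mul,
        one_mul, div_mul_cancel₀ _ hb.ne']
    have h := hg ((-(s / ‖b‖)) • b)
    rw [map_smul, smul_eq_mul, hn, hn', neg_mul] at h
    have h' : s * (β - s) ≤ s / ‖b‖ * g b := by linarith
    rw [div_mul_eq_mul_div, le_div_iff₀ hb, mul_assoc] at h'
    exact le_of_mul_le_mul_left h' hs

theorem convexOn_norm_increment (b : B) {β : ℝ} (hβ : 0 ≤ β) (τ : ℝ) :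
    ConvexOn ℝ Set.univ fun x : B => β * (‖b + x‖ - ‖b‖) + 1 / 2 * ‖x‖ ^ 2 + τ := by
  have h₁ : ConvexOn ℝ Set.univ fun x : B => ‖b + x‖ - ‖b‖ := by
    have := (convexOn_univ_norm (E := B)).translate_right b
    rw [Set.preimage_univ] at this
    exact this.add_const (-‖b‖)
  have h₂ : ConvexOn ℝ Set.univ fun x : B => ‖x‖ ^ 2 :=
    (convexOn_univ_norm (E := B)).pow (fun _ _ => norm_nonneg _) 2
  exact ((h₁.smul hβ).add (h₂.smul (by norm_num : (0 : ℝ) ≤ 1 / 2))).add_const τ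

/-- Lemma 5.5. Let `A` be a closed linear `L`-positive subspace of `B` with
`A⁰` `Λ`-positive (`Λ := -L'`), `d ∈ B`, `c* ∈ B*`, `δ := inf_{a ∈ A} ‖a - d‖` and `η > 0`.
Then there exists `b ∈ A - d` with `ηδ ≤ q_Λ(Lb - c*) + 3‖c*‖η + 5η²`. -/
theorem exists_in_sub_d_qLambda_bound [CompleteSpace B] [Nontrivial B]
    (L : B →L[ℝ] StrongDual ℝ B) (L' : StrongDual ℝ B →L[ℝ] StrongDual ℝ (StrongDual ℝ B))
    (hL : IsSNMap L) (hdual : IsSNDual L L')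
    (A : Submodule ℝ B) (hAc : IsClosed (A : Set B)) (hApos : LPos L (A : Set B))
    (hpolar : LPos (-L') (polarSet (A : Set B)))
    (d : B) (c' : StrongDual ℝ B) (η : ℝ) (hη : 0 < η) :
    ∃ b : B, b + d ∈ A ∧
      η * sInf ((fun a => ‖a - d‖) '' (A : Set B)) ≤
        qL (-L') (L b - c') + 3 * ‖c'‖ * η + 5 * η ^ 2 := by
  set δ := sInf ((fun a => ‖a - d‖) '' (A : Set B))
  have hδle : ∀ b, b + d ∈ A → δ ≤ ‖b‖ := fun b hb =>
    csInf_le ⟨0, by rintro _ ⟨a, -, rfl⟩; exact norm_nonneg _⟩ ⟨b + d, hb, by simp⟩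
  set β : ℝ := 3 / 2 * η with hβ
  let f : B → ℝ := fun b => qL L b - c' b + β * ‖b‖
  by_contra! hcon
  have hbdd : BddBelow (f '' {b | b + d ∈ A}) := by
    refine ⟨-qL L' c' + 3 * ‖c'‖ * η + 5 * η ^ 2, ?_⟩
    rintro _ ⟨b, hb, rfl⟩
    have h₁ := hcon b hb
    rw [hdual.qL_neg_sub] at h₁
    have h₂ : η * δ ≤ η * ‖b‖ := by gcongr; exact hδle b hb
    have h₃ : 0 ≤ η * ‖b‖ := by positivity
    simp only [f, hβ]
    linarith
  obtain ⟨_, ⟨b, hb, rfl⟩, hmin⟩ := exists_lt_of_csInf_lt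
    (s := f '' {b | b + d ∈ A}) ⟨_, -d, by simp, rfl⟩
    (lt_add_of_pos_right _ (show 0 < (η / 2) ^ 2 / 2 by positivity))
  have hdom : ∀ a ∈ A, (c' - L b) a ≤
      β * (‖b + a‖ - ‖b‖) + 1 / 2 * ‖a‖ ^ 2 + (η / 2) ^ 2 / 2 := by
    intro a ha
    have h₁ : sInf (f '' {b | b + d ∈ A}) ≤ f (b + a) :=
      csInf_le hbdd ⟨b + a, by
        have := A.add_mem hb ha
        rwa [add_right_comm] at this, rfl⟩
    have h₂ := qL_le hL.1 a
    have h₃ := hmin.trans_le (add_le_add_left h₁ _)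
    simp only [f, qL_add hL.2, map_add] at h₃
    rw [sub_apply]
    linarith
  obtain ⟨g, hgA, hg⟩ := exists_extension_of_le_convexOn A
    ((c' - L b : StrongDual ℝ B).toLinearMap.comp A.subtype)
    (convexOn_norm_increment b (by positivity : 0 ≤ β) ((η / 2) ^ 2 / 2))
    (fun a => hdom a a.2)
  obtain ⟨hgnorm, hgb⟩ :=
    bounds_of_le_norm_increment (by positivity : 0 ≤ β) (half_pos hη) hg
  have hβ₁ : β + η / 2 = 2 * η := by ring
  have hβ₂ : β - η / 2 = η := by ring
  rw [hβ₁] at hgnorm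
  rw [hβ₂] at hgb
  let r : StrongDual ℝ B := g.mkContinuous (2 * η) hgnorm
  have hr : ‖r‖ ≤ 2 * η := g.mkContinuous_norm_le (by positivity) hgnorm
  have hrb : η * δ - 3 * η ^ 2 ≤ r b := by
    have h₁ : η * δ ≤ η * ‖b‖ := by gcongr; exact hδle b hb
    change _ ≤ g b
    rcases le_total (η / 2) ‖b‖ with h | h
    · nlinarith [hgb h]
    · have h₂ := (abs_le.1 (hgnorm b)).1
      nlinarith
  have hp : c' - L b - r ∈ polarSet (A : Set B) := by
    intro a ha
    have : g a = (c' - L b) a := hgA ⟨a, ha⟩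
    change (c' - L b) a - g a = 0
    rw [this, sub_self]
  have hqp : 0 ≤ qL (-L') (c' - L b - r) := by
    simpa using hpolar.2 _ hp 0 (fun a _ => by simp)
  have hqr := qL_le hdual.1.1 r
  have hrc := (abs_le.1 (abs_apply_apply_le hdual.1.1 r c')).2
  have hexp : qL (-L') (L b - c') =
      qL (-L') (c' - L b - r) + qL L' r + r b - L' r c' := by
    have h₁ : L b - c' = -((c' - L b - r) + r) := by abel
    rw [h₁, qL_neg, qL_neg_map, qL_neg_map, qL_add hdual.1.2, hdual.1.2 r, map_sub, map_sub,
      hdual.2]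
    simp only [qL]
    ring
  have hqr' : -(1 / 2 * ‖r‖ ^ 2) ≤ qL L' r := by
    have := (abs_le.1 (abs_apply_apply_le hdual.1.1 r r)).1
    rw [qL, sq]
    linarith
  have hr2 : ‖r‖ ^ 2 ≤ (2 * η) ^ 2 := by gcongr
  have hrc' : ‖r‖ * ‖c'‖ ≤ 2 * η * ‖c'‖ := by gcongr
  have hpos : 0 ≤ η * ‖c'‖ := by positivity
  have := hcon b hb
  linarith
end

section
/- Let (B, L) be a Banach SN space with Banach SN dual (B*, L̃), and set Λ := −L̃. Let A be a closed linear L-positive subspace of B such that A⁰ is Λ-positive, let c* ∈ B* and η > 0. Then there exists b ∈ A such that 0 ≤ q_Λ(Lb − c*) + 3‖c*‖η + 5η². -/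
open NormedSpace

variable {B : Type*} [NormedAddCommGroup B] [NormedSpace ℝ B]

set_option maxSynthPendingDepth 3

lemma IsSNMap.apply_le {E : Type*} [NormedAddCommGroup E] [NormedSpace ℝ E]
    {L : E →L[ℝ] StrongDual ℝ E} (hL : IsSNMap L) (b c : E) : |L b c| ≤ ‖b‖ * ‖c‖ := by
  have h := L.le_opNorm₂ b c
  rw [Real.norm_eq_abs, mul_assoc] at h
  exact h.trans (mul_le_of_le_one_left (by positivity) hL.1)

/-- An almost maximizer `b` over `A` of the concave function `a ↦ c a - q_L(a)` has residual
`c - L b` which is small on `A` with respect to `q_L`. -/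
lemma IsSNMap.sq_residual_le {L : B →L[ℝ] StrongDual ℝ B} (hL : IsSNMap L) {A : Submodule ℝ B}
    {c : StrongDual ℝ B} {M δ : ℝ} (hM : ∀ a ∈ A, c a - 1 / 2 * L a a ≤ M) {b : B} (hb : b ∈ A)
    (hbM : M - δ ≤ c b - 1 / 2 * L b b) {a : B} (ha : a ∈ A) :
    (c a - L b a) ^ 2 ≤ 2 * δ * L a a := by
  have key : ∀ t : ℝ, 0 ≤ (1 / 2 * L a a) * (t * t) + -(c a - L b a) * t + δ := by
    intro t
    have h := hM (b + t • a) (A.add_mem hb (A.smul_mem t ha))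
    simp only [map_add, map_smul, add_apply, smul_apply, smul_eq_mul] at h
    rw [hL.2 b a] at h
    linarith
  have h := discrim_le_zero key
  rw [discrim] at h
  linarith

/-- A functional that is bounded by `ρ` on `A` splits as the sum of a functional of norm at most
`ρ` and one that vanishes on `A`. -/
lemma exists_norm_le_eqOn {A : Submodule ℝ B} {r : StrongDual ℝ B} {ρ : ℝ} (hρ : 0 ≤ ρ)
    (hr : ∀ a ∈ A, |r a| ≤ ρ * ‖a‖) : ∃ d : StrongDual ℝ B, ‖d‖ ≤ ρ ∧ ∀ a ∈ A, d a = r a := by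
  obtain ⟨d, hd, hnorm⟩ := exists_extension_norm_eq A (r.comp A.subtypeL)
  refine ⟨d, ?_, fun a ha => hd ⟨a, ha⟩⟩
  rw [hnorm]
  exact ContinuousLinearMap.opNorm_le_bound _ hρ fun a => hr a a.2

/-- Corollary 5.7. Let `A` be a closed linear `L`-positive subspace of `B`
with `A⁰` `Λ`-positive, `c* ∈ B*` and `η > 0`.  Then there exists `b ∈ A` such that
`0 ≤ q_Λ(Lb - c*) + 3‖c*‖η + 5η²`. -/
theorem exists_mem_qLambda_bound [CompleteSpace B] [Nontrivial B]
    (L : B →L[ℝ] StrongDual ℝ B) (L' : StrongDual ℝ B →L[ℝ] StrongDual ℝ (StrongDual ℝ B))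
    (hL : IsSNMap L) (hdual : IsSNDual L L')
    (A : Submodule ℝ B) (hAc : IsClosed (A : Set B)) (hApos : LPos L (A : Set B))
    (hpolar : LPos (-L') (polarSet (A : Set B)))
    (c' : StrongDual ℝ B) (η : ℝ) (hη : 0 < η) :
    ∃ b ∈ A, 0 ≤ qL (-L') (L b - c') + 3 * ‖c'‖ * η + 5 * η ^ 2 := by
  obtain ⟨hL', hd⟩ := hdual
  have hq : ∀ b, qL (-L') (L b - c') = c' b - 1 / 2 * L b b - 1 / 2 * L' c' c' := by
    intro b
    have h₁ := hL'.2 (L b) c'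
    simp only [qL, neg_apply, map_sub, sub_apply, hd] at h₁ ⊢
    linarith
  by_cases hbdd : ∃ b ∈ A, 1 / 2 * L' c' c' ≤ c' b - 1 / 2 * L b b
  · obtain ⟨b, hb, h⟩ := hbdd
    refine ⟨b, hb, ?_⟩
    have hslack : 0 ≤ 3 * ‖c'‖ * η + 5 * η ^ 2 := by positivity
    rw [hq]
    linarith
  push Not at hbdd
  set φ : A → ℝ := fun a => c' a - 1 / 2 * L a a
  have hφb : BddAbove (Set.range φ) :=
    ⟨1 / 2 * L' c' c', by rintro _ ⟨a, rfl⟩; exact (hbdd a a.2).le⟩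
  set M := ⨆ a, φ a
  have hM : ∀ a ∈ A, c' a - 1 / 2 * L a a ≤ M := fun a ha => le_ciSup hφb ⟨a, ha⟩
  have hM0 : 0 ≤ M := by simpa using hM 0 A.zero_mem
  obtain ⟨ρ, hρ0, hρη, hρM⟩ : ∃ ρ : ℝ, 0 < ρ ∧ ρ ≤ η ∧ 8 * M * ρ ^ 2 ≤ η ^ 4 := by
    refine ⟨min η (η ^ 2 / (8 * M + 1)), by positivity, min_le_left _ _, ?_⟩
    calc 8 * M * min η (η ^ 2 / (8 * M + 1)) ^ 2
        ≤ 8 * M * (η ^ 2 / (8 * M + 1)) ^ 2 := by gcongr; exact min_le_right _ _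
      _ = η ^ 4 * (8 * M / (8 * M + 1) ^ 2) := by rw [div_pow]; ring
      _ ≤ η ^ 4 := by
        refine mul_le_of_le_one_right (by positivity) ?_
        rw [div_le_one (by positivity)]
        nlinarith
  obtain ⟨⟨b, hb⟩, hbM⟩ : ∃ b, M - ρ ^ 2 / 2 < φ b :=
    exists_lt_of_lt_ciSup (sub_lt_self _ (by positivity))
  replace hbM : M - ρ ^ 2 / 2 ≤ c' b - 1 / 2 * L b b := hbM.le
  have hres : ∀ a ∈ A, (c' a - L b a) ^ 2 ≤ ρ ^ 2 * L a a := fun a ha =>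
    (hL.sq_residual_le hM hb hbM ha).trans_eq (by ring)
  have hLb : L b b ≤ 8 * M + 2 * ρ ^ 2 := by
    have h := hM ((1 / 2 : ℝ) • b) (A.smul_mem _ hb)
    simp only [map_smul, smul_apply, smul_eq_mul] at h
    linarith
  have hrb : |c' b - L b b| ≤ 2 * η ^ 2 := by
    apply abs_le_of_sq_le_sq _ (by positivity)
    have h₁ : ρ ^ 4 ≤ η ^ 4 := by gcongr
    nlinarith [hres b hb, mul_le_mul_of_nonneg_left hLb (sq_nonneg ρ)]
  obtain ⟨d, hdρ, hdA⟩ := exists_norm_le_eqOn (A := A) (r := c' - L b) hρ0.le (by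
    intro a ha
    apply abs_le_of_sq_le_sq _ (by positivity)
    have h := (le_abs_self _).trans (hL.apply_le a a)
    calc ((c' - L b) a) ^ 2 ≤ ρ ^ 2 * L a a := hres a ha
      _ ≤ ρ ^ 2 * (‖a‖ * ‖a‖) := by gcongr
      _ = (ρ * ‖a‖) ^ 2 := by ring)
  have hx : L' (c' - L b - d) (c' - L b - d) ≤ 0 := by
    have h := hpolar.2 (c' - L b - d) (fun a ha => by rw [sub_apply, hdA a ha, sub_self])
      0 (fun a _ => rfl)
    simp only [qL, sub_zero, neg_apply] at h
    linarith
  have hdb : d b = c' b - L b b := hdA b hb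
  have hcd : L' c' d ≤ ‖c'‖ * η :=
    (le_abs_self _).trans ((hL'.apply_le c' d).trans (by gcongr; exact hdρ.trans hρη))
  have hdd : 0 ≤ L' d d + η ^ 2 := by
    have h : ‖d‖ * ‖d‖ ≤ η * η := by gcongr <;> exact hdρ.trans hρη
    nlinarith [neg_abs_le (L' d d), hL'.apply_le d d]
  have hc : 0 ≤ ‖c'‖ * η := by positivity
  refine ⟨b, hb, ?_⟩
  rw [hq]
  have h₁ := hL'.2 (L b) c'
  have h₂ := hL'.2 (L b) d
  have h₃ := hL'.2 c' d
  simp only [map_sub, sub_apply, hd] at hx h₁ h₂ h₃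
  nlinarith [abs_le.mp hrb, sq_nonneg η]
end

section
/- Let (B, L) be a Banach SN space with Banach SN dual (B*, L̃), set Λ := −L̃, suppose L(B) = B* (L is surjective onto B*), and let A be a closed linear L-positive subspace of B. Then A is maximally L-positive if, and only if, A⁰ is Λ-positive. -/
open NormedSpace

variable {B : Type*} [NormedAddCommGroup B] [NormedSpace ℝ B]

set_option maxSynthPendingDepth 3

/-- Fenchel-type sandwich for `½‖·‖²`: if `m` is a lower bound of `½‖x‖² + q_L(x)` on the
translate `A - b` of an `L`-positive subspace, then an affine function fits between. -/
theorem exists_affine_between_norm_sq (L : B →L[ℝ] StrongDual ℝ B)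
    (hsymm : ∀ b c : B, L c b = L b c) (A : Submodule ℝ B) (hA : ∀ a ∈ A, 0 ≤ L a a)
    (b : B) (m : ℝ) (hm : ∀ x, x + b ∈ A → m ≤ 1 / 2 * ‖x‖ ^ 2 + 1 / 2 * L x x) :
    ∃ (f : StrongDual ℝ B) (α : ℝ), (∀ x, f x + α ≤ 1 / 2 * ‖x‖ ^ 2) ∧
      ∀ x, x + b ∈ A → m ≤ f x + α + 1 / 2 * L x x := by
  let S : Set (B × ℝ) := {p | 1 / 2 * ‖p.1‖ ^ 2 < p.2}
  let T : Set (B × ℝ) := {p | p.1 + b ∈ A ∧ p.2 ≤ m - 1 / 2 * L p.1 p.1}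
  have hSo : IsOpen S := isOpen_lt (by fun_prop) (by fun_prop)
  have hSc : Convex ℝ S := by
    have h : ConvexOn ℝ Set.univ (fun x : B => 1 / 2 * ‖x‖ ^ 2) := by
      have := ((convexOn_univ_norm (E := B)).pow (fun _ _ => norm_nonneg _) 2).smul
        (by norm_num : (0 : ℝ) ≤ 1 / 2)
      simpa using this
    simpa [S] using h.convex_strict_epigraph
  have hTc : Convex ℝ T := by
    rintro ⟨x, s⟩ ⟨hx, hs⟩ ⟨y, t⟩ ⟨hy, ht⟩ u v hu hv huv
    have hxy : 0 ≤ L (x - y) (x - y) := hA _ (by simpa using A.sub_mem hx hy)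
    have e : v = 1 - u := by linarith
    subst e
    refine ⟨?_, ?_⟩
    · have := A.add_mem (A.smul_mem u hx) (A.smul_mem (1 - u) hy)
      convert this using 1
      simp only [Prod.fst_add, Prod.smul_fst]
      module
    · have h := mul_nonneg (mul_nonneg hu hv) hxy
      simp only [Prod.fst_add, Prod.smul_fst, Prod.snd_add, Prod.smul_snd, map_add, map_sub,
        map_smul, add_apply, sub_apply,
        smul_apply, smul_eq_mul, hsymm y x] at h hs ht ⊢
      nlinarith [mul_le_mul_of_nonneg_left hs hu, mul_le_mul_of_nonneg_left ht hv]
  have hd : Disjoint S T := by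
    rw [Set.disjoint_left]
    rintro ⟨x, s⟩ hS ⟨hx, hs⟩
    have h := hm x hx
    simp only [S, Set.mem_ofPred_eq] at hS hs
    linarith
  obtain ⟨F, u, hFS, hFT⟩ := geometric_hahn_banach_open hSc hSo hTc hd
  have hF : ∀ x t, F (x, t) = F (x, 0) + t * F (0, 1) := by
    intro x t
    rw [← smul_eq_mul, ← map_smul, ← map_add]
    simp
  set κ := F (0, 1)
  have hκneg : κ < 0 := by
    by_contra! hcon
    have h1 := hFT (-b, m - 1 / 2 * L (-b) (-b)) ⟨by simp, le_rfl⟩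
    have h2 := hFS (-b, max (m - 1 / 2 * L (-b) (-b)) (1 / 2 * ‖(-b)‖ ^ 2 + 1)) (by
      simp only [S, Set.mem_ofPred_eq]
      exact lt_of_lt_of_le (by linarith) (le_max_right _ _))
    rw [hF] at h1 h2
    nlinarith [mul_le_mul_of_nonneg_right (le_max_left (m - 1 / 2 * L (-b) (-b))
      (1 / 2 * ‖(-b)‖ ^ 2 + 1)) hcon]
  refine ⟨(-κ)⁻¹ • F.comp (ContinuousLinearMap.inl ℝ B ℝ), (-κ)⁻¹ * (-u), ?_, ?_⟩
  · intro x
    have h : F (x, 0) + 1 / 2 * ‖x‖ ^ 2 * κ ≤ u := by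
      refine le_of_forall_pos_lt_add fun ε hε => ?_
      have h := hFS (x, 1 / 2 * ‖x‖ ^ 2 + ε / (-κ)) (by
        simp only [S, Set.mem_ofPred_eq]
        have : 0 < ε / (-κ) := div_pos hε (by linarith)
        linarith)
      rw [hF] at h
      have e : ε / (-κ) * κ = -ε := by
        rw [div_mul_eq_mul_div, div_eq_iff (by linarith)]
        ring
      linarith
    simp only [smul_apply, ContinuousLinearMap.comp_apply,
      ContinuousLinearMap.inl_apply, smul_eq_mul]
    rw [← mul_add, inv_mul_le_iff₀ (by linarith)]
    linarith
  · intro x hx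
    have h := hFT (x, m - 1 / 2 * L x x) ⟨hx, le_rfl⟩
    rw [hF] at h
    simp only [smul_apply, ContinuousLinearMap.comp_apply,
      ContinuousLinearMap.inl_apply, smul_eq_mul]
    rw [← mul_add, ← sub_le_iff_le_add, le_inv_mul_iff₀ (by linarith)]
    linarith

theorem sq_le_of_forall_quadratic_nonneg {p r s : ℝ}
    (h : ∀ t : ℝ, 0 ≤ p * t ^ 2 + r * t + s) : r ^ 2 ≤ 4 * p * s := by
  have := discrim_le_zero (a := p) (b := r) (c := s) (fun t => by have := h t; nlinarith)
  rw [discrim] at this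
  linarith

theorem norm_sq_le_of_forall_apply_add_le (f : StrongDual ℝ B) (α : ℝ)
    (h : ∀ x, f x + α ≤ 1 / 2 * ‖x‖ ^ 2) : ‖f‖ ^ 2 ≤ -(2 * α) := by
  have hα : 0 ≤ -(2 * α) := by
    have := h 0
    simp at this
    linarith
  rw [← Real.le_sqrt (norm_nonneg _) hα]
  refine f.opNorm_le_bound (Real.sqrt_nonneg _) fun x => ?_
  rw [Real.norm_eq_abs]
  refine abs_le_of_sq_le_sq ?_ (by positivity)
  rw [mul_pow, Real.sq_sqrt hα]
  have := sq_le_of_forall_quadratic_nonneg (p := 1 / 2 * ‖x‖ ^ 2) (r := -f x) (s := -α)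
    (fun t => by
      have := h (t • x)
      rw [norm_smul, map_smul, smul_eq_mul, mul_pow, Real.norm_eq_abs, sq_abs] at this
      linarith)
  linarith

theorem abs_apply_self_le_norm_sq (L : B →L[ℝ] StrongDual ℝ B) (hL : ‖L‖ ≤ 1) (x : B) :
    |L x x| ≤ ‖x‖ ^ 2 := by
  have h := L.le_opNorm₂ x x
  rw [Real.norm_eq_abs] at h
  nlinarith [norm_nonneg x, mul_le_mul_of_nonneg_right hL (sq_nonneg ‖x‖)]

theorem IsSNDual.norm_le_norm_apply {L : B →L[ℝ] StrongDual ℝ B}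
    {L' : StrongDual ℝ B →L[ℝ] StrongDual ℝ (StrongDual ℝ B)} (h : IsSNDual L L') (x : B) :
    ‖x‖ ≤ ‖L x‖ := by
  refine norm_le_dual_bound ℝ x (norm_nonneg _) fun f => ?_
  rw [← h.2 x f]
  refine (L'.le_opNorm₂ f (L x)).trans ?_
  have h1 : ‖L'‖ * ‖f‖ ≤ 1 * ‖f‖ := mul_le_mul_of_nonneg_right h.1.1 (norm_nonneg _)
  nlinarith [mul_le_mul_of_nonneg_right h1 (norm_nonneg (L x))]

/-- A point where `q_L` is almost minimal along an `L`-positive subspace `A` is close to the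
`L`-orthogonal complement of `A`. -/
theorem exists_norm_le_and_orthogonal (L : B →L[ℝ] StrongDual ℝ B) (hL : IsSNMap L)
    (hexp : ∀ x, ‖x‖ ≤ ‖L x‖) (hsurj : Function.Surjective L) (A : Submodule ℝ B)
    (w : B) (δ : ℝ) (hδ : 0 ≤ δ)
    (hw : ∀ a ∈ A, 1 / 2 * L w w ≤ 1 / 2 * L (w + a) (w + a) + δ ^ 2 / 2) :
    ∃ u, ‖u‖ ≤ δ ∧ ∀ a ∈ A, L (w - u) a = 0 := by
  obtain ⟨g, hg, hgn⟩ := exists_extension_norm_eq A ((L w).comp A.subtypeL)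
  obtain ⟨u, rfl⟩ := hsurj g
  refine ⟨u, (hexp u).trans ?_, fun a ha => ?_⟩
  · rw [hgn]
    refine ContinuousLinearMap.opNorm_le_bound _ hδ fun a => ?_
    rw [Real.norm_eq_abs]
    refine abs_le_of_sq_le_sq ?_ (by positivity)
    have h := sq_le_of_forall_quadratic_nonneg (p := 1 / 2 * L a a) (r := L w a) (s := δ ^ 2 / 2)
      (fun t => by
        have h := hw (t • (a : B)) (A.smul_mem t a.2)
        simp only [map_add, map_smul, add_apply,
          smul_apply, smul_eq_mul, hL.2 w (a : B)] at h
        linarith)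
    have h2 := (abs_le.1 (abs_apply_self_le_norm_sq L hL.1 (a : B))).2
    change (L w a) ^ 2 ≤ (δ * ‖(a : B)‖) ^ 2
    nlinarith [mul_le_mul_of_nonneg_right h2 (sq_nonneg δ)]
  · have h := hg ⟨a, ha⟩
    simp only [ContinuousLinearMap.comp_apply, Submodule.subtypeL_apply] at h
    rw [map_sub, sub_apply, h, sub_self]

/-- If `q_L ≤ 0` on the `L`-orthogonal complement of a closed `L`-positive subspace `A`, then every
point that is `L`-positively related to `A` belongs to `A`. -/
theorem mem_of_forall_nonneg_of_orthogonal_nonpos (L : B →L[ℝ] StrongDual ℝ B) (hL : IsSNMap L)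
    (hexp : ∀ x, ‖x‖ ≤ ‖L x‖) (hsurj : Function.Surjective L) (A : Submodule ℝ B)
    (hAc : IsClosed (A : Set B)) (hA : ∀ a ∈ A, 0 ≤ L a a)
    (horth : ∀ y, (∀ a ∈ A, L y a = 0) → L y y ≤ 0) (b : B)
    (hb : ∀ x, x + b ∈ A → 0 ≤ L x x) : b ∈ A := by
  set P : Set ℝ := (fun x => 1 / 2 * ‖x‖ ^ 2 + 1 / 2 * L x x) '' {x | x + b ∈ A}
  have hPne : P.Nonempty := ⟨_, -b, by simp, rfl⟩
  have hPbdd : BddBelow P := by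
    refine ⟨0, ?_⟩
    rintro _ ⟨x, hx, rfl⟩
    have := hb x hx
    positivity
  have hPlt : ∀ ε > 0, ∃ x, x + b ∈ A ∧ 1 / 2 * ‖x‖ ^ 2 + 1 / 2 * L x x < sInf P + ε := by
    intro ε hε
    obtain ⟨_, ⟨x, hx, rfl⟩, h⟩ := exists_lt_of_csInf_lt hPne (lt_add_of_pos_right (sInf P) hε)
    exact ⟨x, hx, h⟩
  have hm : ∀ x, x + b ∈ A → sInf P ≤ 1 / 2 * ‖x‖ ^ 2 + 1 / 2 * L x x :=
    fun x hx => csInf_le hPbdd ⟨x, hx, rfl⟩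
  generalize sInf P = m at hPlt hm
  have hm0 : m ≤ 0 := by
    by_contra! hpos
    obtain ⟨f, α, hf, hfA⟩ := exists_affine_between_norm_sq L hL.2 A hA b m hm
    have hfn := norm_sq_le_of_forall_apply_add_le f α hf
    obtain ⟨z, rfl⟩ := hsurj f
    have hz : ‖z‖ ^ 2 ≤ -(2 * α) :=
      (pow_le_pow_left₀ (norm_nonneg z) (hexp z) 2).trans hfn
    have hqz := (abs_le.1 (abs_apply_self_le_norm_sq L hL.1 z)).1
    have hexpand : ∀ x, L (x + z) (x + z) = L x x + 2 * L z x + L z z := by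
      intro x
      simp only [map_add, add_apply, hL.2 z x]
      ring
    obtain ⟨K, hK⟩ : ∃ K, K = 2 * m + 2 + ‖z‖ + 1 := ⟨_, rfl⟩
    have hKpos : 0 < K := by have := norm_nonneg z; linarith
    obtain ⟨δ, hδ0, hδ1, hδ⟩ : ∃ δ : ℝ, 0 < δ ∧ δ ≤ 1 ∧ δ * K < m := by
      refine ⟨min 1 (m / (2 * K)), by positivity, min_le_left _ _, ?_⟩
      have h : m / (2 * K) * K = m / 2 := by field_simp
      have h2 := mul_le_mul_of_nonneg_right (min_le_right 1 (m / (2 * K))) hKpos.le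
      linarith
    obtain ⟨c, hc, hcm⟩ := hPlt (δ ^ 2 / 2) (by positivity)
    obtain ⟨u, hu, hyA⟩ := exists_norm_le_and_orthogonal L hL hexp hsurj A (c + z) δ hδ0.le
      (fun a ha => by
        have h := hfA (c + a) (by simpa [add_right_comm] using A.add_mem hc ha)
        rw [add_right_comm, hexpand, hexpand]
        have := hf c
        linarith)
    have hy := horth _ hyA
    have hyexp : L (c + z - u) (c + z - u)
        = L (c + z) (c + z) - 2 * L u (c + z) + L u u := by
      simp only [map_sub, sub_apply, hL.2 u (c + z)]
      ring
    have hqu := (abs_le.1 (abs_apply_self_le_norm_sq L hL.1 u)).1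
    have hLu : L u (c + z) ≤ δ * ‖c + z‖ := by
      refine (le_abs_self _).trans ((L.le_opNorm₂ u (c + z)).trans ?_)
      refine mul_le_mul_of_nonneg_right ?_ (norm_nonneg _)
      nlinarith [mul_le_mul_of_nonneg_right hL.1 (norm_nonneg u)]
    have hδsq : δ ^ 2 ≤ δ := by nlinarith
    have husq : ‖u‖ ^ 2 ≤ δ ^ 2 := pow_le_pow_left₀ (norm_nonneg u) hu 2
    have hcn : ‖c‖ ≤ 2 * m + 2 := by nlinarith [hb c hc, sq_nonneg (‖c‖ - 1)]
    have hcz : δ * ‖c + z‖ ≤ δ * (2 * m + 2 + ‖z‖) :=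
      mul_le_mul_of_nonneg_left ((norm_add_le c z).trans (by linarith)) hδ0.le
    have hlow := hfA c hc
    have hq := hexpand c
    subst hK
    linarith
  rw [← SetLike.mem_coe, ← hAc.closure_eq, Metric.mem_closure_iff]
  intro ε hε
  obtain ⟨x, hx, hlt⟩ := hPlt (ε ^ 2 / 2) (by positivity)
  refine ⟨x + b, hx, ?_⟩
  rw [dist_comm, dist_eq_norm, add_sub_cancel_right]
  refine lt_of_pow_lt_pow_left₀ 2 hε.le ?_
  linarith [hb x hx]

/-- Corollary 5.12. Let `A` be a closed linear `L`-positive subspace of `B`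
and `L(B) = B*`.  Then `A` is maximally `L`-positive iff `A⁰` is `Λ`-positive (`Λ := -L'`). -/
theorem maxLPos_iff_polar_LambdaPos_of_surjective [CompleteSpace B] [Nontrivial B]
    (L : B →L[ℝ] StrongDual ℝ B) (L' : StrongDual ℝ B →L[ℝ] StrongDual ℝ (StrongDual ℝ B))
    (hL : IsSNMap L) (hdual : IsSNDual L L') (hsurj : Function.Surjective (⇑L))
    (A : Submodule ℝ B) (hAc : IsClosed (A : Set B)) (hApos : LPos L (A : Set B)) :
    MaxLPos L (A : Set B) ↔ LPos (-L') (polarSet (A : Set B)) := by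
  have hA : ∀ a ∈ A, 0 ≤ L a a := fun a ha => by
    have h := hApos.2 a ha 0 A.zero_mem
    rw [sub_zero, qL] at h
    linarith
  constructor
  · rintro ⟨-, hmax⟩
    refine ⟨⟨0, fun _ _ => rfl⟩, fun f hf g hg => ?_⟩
    obtain ⟨y, hy⟩ := hsurj (f - g)
    have hyA : ∀ a ∈ A, L y a = 0 := fun a ha => by
      rw [hy, sub_apply, hf a ha, hg a ha, sub_self]
    rw [qL, ← hy, neg_apply, neg_apply, hdual.2]
    suffices L y y ≤ 0 by linarith
    by_contra! hpos
    have hrel : ∀ a ∈ A, 0 ≤ L a a - 2 * L y a + L y y := fun a ha => by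
      rw [hyA a ha]
      linarith [hA a ha]
    have hins : LPos L (insert y (A : Set B)) := by
      refine ⟨⟨y, Set.mem_insert _ _⟩, ?_⟩
      rintro p (rfl | hp) r (rfl | hr)
      · simp [qL]
      · have := hrel r hr
        simp only [qL, map_sub, sub_apply, hL.2 p r]
        linarith
      · have := hrel p hp
        simp only [qL, map_sub, sub_apply, hL.2 r p]
        linarith
      · exact hApos.2 p hp r hr
    have hyA' : y ∈ (A : Set B) := by
      rw [← hmax _ hins (Set.subset_insert _ _)]
      exact Set.mem_insert _ _
    exact hpos.ne' (hyA y hyA')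
  · rintro ⟨-, hpol⟩
    refine ⟨hApos, fun C hC hAC => (Set.Subset.antisymm hAC fun b hb => ?_).symm⟩
    refine mem_of_forall_nonneg_of_orthogonal_nonpos L hL hdual.norm_le_norm_apply hsurj A hAc hA
      (fun y hy => ?_) b (fun x hx => ?_)
    · have h := hpol (L y) hy 0 (fun _ _ => rfl)
      rw [sub_zero, qL, neg_apply, neg_apply,
        hdual.2] at h
      linarith
    · have h := hC.2 (x + b) (hAC hx) b hb
      rw [add_sub_cancel_right, qL] at h
      linarith
end

section
/- Let E be a nonzero real Banach space, B := E × E* with norm ‖(x, x*)‖ := √(‖x‖² + ‖x*‖²), B* identified with E* × E** under the pairing ⟨(x, x*), (y*, y**)⟩ := ⟨x, y*⟩ + ⟨x*, y**⟩, and L : B → B* defined by L(x, x*) := (x*, x̂), where x ↦ x̂ is the canonical embedding of E into E**. Then (B, L) is a Banach SN space with q_L(x, x*) = ⟨x, x*⟩ for all (x, x*) ∈ B, and the map L̃ : B* → B** defined by L̃(y*, y**) := (y**, ŷ*) makes (B*, L̃) a Banach SN dual of (B, L), i.e. ⟨Lb, L̃b*⟩ = ⟨b, b*⟩ for all b ∈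 B and b* ∈ B*. -/
open NormedSpace

variable {B : Type*} [NormedAddCommGroup B] [NormedSpace ℝ B]

/-- The symmetric bilinear map `(z, w) ↦ ⟨p w, q z⟩ + ⟨p z, q w⟩` induced by continuous linear maps
`p : Z → X` and `q : Z → X*`. -/
noncomputable def symmPairing {X Z : Type*} [NormedAddCommGroup X] [NormedSpace ℝ X]
    [NormedAddCommGroup Z] [NormedSpace ℝ Z] (p : Z →L[ℝ] X) (q : Z →L[ℝ] StrongDual ℝ X) :
    Z →L[ℝ] StrongDual ℝ Z :=
  ContinuousLinearMap.bilinearComp (ContinuousLinearMap.id ℝ (StrongDual ℝ X)) q p +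
    (ContinuousLinearMap.bilinearComp (ContinuousLinearMap.id ℝ (StrongDual ℝ X)) q p).flip

theorem symmPairing_apply {X Z : Type*} [NormedAddCommGroup X] [NormedSpace ℝ X]
    [NormedAddCommGroup Z] [NormedSpace ℝ Z] (p : Z →L[ℝ] X) (q : Z →L[ℝ] StrongDual ℝ X)
    (z w : Z) : symmPairing p q z w = q z (p w) + q w (p z) := by
  simp [symmPairing]

theorem isSNMap_symmPairing {X Z : Type*} [NormedAddCommGroup X] [NormedSpace ℝ X]
    [NormedAddCommGroup Z] [NormedSpace ℝ Z] (p : Z →L[ℝ] X) (q : Z →L[ℝ] StrongDual ℝ X)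
    (h : ∀ z, ‖p z‖ ^ 2 + ‖q z‖ ^ 2 ≤ ‖z‖ ^ 2) : IsSNMap (symmPairing p q) := by
  refine ⟨ContinuousLinearMap.opNorm_le_bound₂ _ zero_le_one fun z w => ?_, fun z w => ?_⟩
  · rw [symmPairing_apply, one_mul]
    have hzw : ‖q z (p w) + q w (p z)‖ ≤ ‖q z‖ * ‖p w‖ + ‖q w‖ * ‖p z‖ :=
      (norm_add_le _ _).trans (add_le_add ((q z).le_opNorm _) ((q w).le_opNorm _))
    refine hzw.trans (abs_le_of_sq_le_sq' ?_ (by positivity)).2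
    calc (‖q z‖ * ‖p w‖ + ‖q w‖ * ‖p z‖) ^ 2
        ≤ (‖p z‖ ^ 2 + ‖q z‖ ^ 2) * (‖p w‖ ^ 2 + ‖q w‖ ^ 2) := by
          nlinarith [sq_nonneg (‖q z‖ * ‖q w‖ - ‖p w‖ * ‖p z‖)]
      _ ≤ ‖z‖ ^ 2 * ‖w‖ ^ 2 := mul_le_mul (h z) (h w) (by positivity) (by positivity)
      _ = (‖z‖ * ‖w‖) ^ 2 := by ring
  · rw [symmPairing_apply, symmPairing_apply, add_comm]

/-- If two functionals `f`, `g` satisfy `(f x)² + (g y)² ≤ M²` on the closed unit balls, then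
`‖f‖² + ‖g‖² ≤ M²`. -/
theorem sq_norm_add_sq_norm_le {X Y : Type*} [NormedAddCommGroup X] [NormedSpace ℝ X]
    [NormedAddCommGroup Y] [NormedSpace ℝ Y] (f : StrongDual ℝ X) (g : StrongDual ℝ Y) (M : ℝ)
    (h : ∀ x y, ‖x‖ ≤ 1 → ‖y‖ ≤ 1 → f x ^ 2 + g y ^ 2 ≤ M ^ 2) :
    ‖f‖ ^ 2 + ‖g‖ ^ 2 ≤ M ^ 2 := by
  have hf : ∀ y, ‖y‖ ≤ 1 → ‖f‖ ^ 2 + g y ^ 2 ≤ M ^ 2 := fun y hy => by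
    have h0 : g y ^ 2 ≤ M ^ 2 := by simpa using h 0 y (by simp) hy
    have h1 : ‖f‖ ≤ √(M ^ 2 - g y ^ 2) :=
      ContinuousLinearMap.opNorm_le_of_unit_norm (Real.sqrt_nonneg _) fun x hx =>
        Real.abs_le_sqrt (by linarith [h x y hx.le hy])
    rw [Real.le_sqrt (norm_nonneg _) (by linarith)] at h1
    linarith
  have h0 : ‖f‖ ^ 2 ≤ M ^ 2 := by simpa using hf 0 (by simp)
  have h1 : ‖g‖ ≤ √(M ^ 2 - ‖f‖ ^ 2) :=
    ContinuousLinearMap.opNorm_le_of_unit_norm (Real.sqrt_nonneg _) fun y hy =>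
      Real.abs_le_sqrt (by linarith [hf y hy.le])
  rw [Real.le_sqrt (norm_nonneg _) (by linarith)] at h1
  linarith

/-- Restriction of a functional on `X × Y` (with the `ℓ²` norm) to the first factor. -/
noncomputable def dualRestrictFst (X Y : Type*) [NormedAddCommGroup X] [NormedSpace ℝ X]
    [NormedAddCommGroup Y] [NormedSpace ℝ Y] :
    StrongDual ℝ (WithLp 2 (X × Y)) →L[ℝ] StrongDual ℝ X :=
  ContinuousLinearMap.precomp ℝ
    ((WithLp.prodContinuousLinearEquiv 2 ℝ X Y).symm.toContinuousLinearMap.comp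
      (ContinuousLinearMap.inl ℝ X Y))

/-- Restriction of a functional on `X × Y` (with the `ℓ²` norm) to the second factor. -/
noncomputable def dualRestrictSnd (X Y : Type*) [NormedAddCommGroup X] [NormedSpace ℝ X]
    [NormedAddCommGroup Y] [NormedSpace ℝ Y] :
    StrongDual ℝ (WithLp 2 (X × Y)) →L[ℝ] StrongDual ℝ Y :=
  ContinuousLinearMap.precomp ℝ
    ((WithLp.prodContinuousLinearEquiv 2 ℝ X Y).symm.toContinuousLinearMap.comp
      (ContinuousLinearMap.inr ℝ X Y))

section DualRestrict

variable {X Y : Type*} [NormedAddCommGroup X] [NormedSpace ℝ X] [NormedAddCommGroup Y]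
  [NormedSpace ℝ Y]

theorem dualRestrictFst_apply (f : StrongDual ℝ (WithLp 2 (X × Y))) (x : X) :
    dualRestrictFst X Y f x = f (WithLp.toLp 2 (x, 0)) := rfl

theorem dualRestrictSnd_apply (f : StrongDual ℝ (WithLp 2 (X × Y))) (y : Y) :
    dualRestrictSnd X Y f y = f (WithLp.toLp 2 (0, y)) := rfl

theorem dualRestrictFst_add_dualRestrictSnd (f : StrongDual ℝ (WithLp 2 (X × Y))) (x : X) (y : Y) :
    dualRestrictFst X Y f x + dualRestrictSnd X Y f y = f (WithLp.toLp 2 (x, y)) := by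
  rw [dualRestrictFst_apply, dualRestrictSnd_apply, ← map_add, ← WithLp.toLp_add,
    Prod.mk_add_mk, add_zero, zero_add]

theorem sq_norm_dualRestrict_le (f : StrongDual ℝ (WithLp 2 (X × Y))) :
    ‖dualRestrictFst X Y f‖ ^ 2 + ‖dualRestrictSnd X Y f‖ ^ 2 ≤ ‖f‖ ^ 2 := by
  refine sq_norm_add_sq_norm_le _ _ _ fun x y hx hy => ?_
  set a := dualRestrictFst X Y f x with ha
  set b := dualRestrictSnd X Y f y with hb
  have hv : ‖WithLp.toLp 2 (a • x, b • y)‖ ^ 2 ≤ a ^ 2 + b ^ 2 := by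
    rw [WithLp.prod_norm_sq_eq_of_L2]
    change ‖a • x‖ ^ 2 + ‖b • y‖ ^ 2 ≤ _
    simp only [norm_smul, mul_pow, Real.norm_eq_abs, sq_abs]
    exact add_le_add
      (mul_le_of_le_one_right (sq_nonneg _) (pow_le_one₀ (norm_nonneg _) hx))
      (mul_le_of_le_one_right (sq_nonneg _) (pow_le_one₀ (norm_nonneg _) hy))
  have hf : a ^ 2 + b ^ 2 ≤ ‖f‖ * ‖WithLp.toLp 2 (a • x, b • y)‖ := by
    refine le_trans (le_of_eq ?_) ((le_abs_self _).trans (f.le_opNorm _))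
    rw [← dualRestrictFst_add_dualRestrictSnd, map_smul, map_smul, ← ha, ← hb, smul_eq_mul,
      smul_eq_mul]
    ring
  rcases (add_nonneg (sq_nonneg a) (sq_nonneg b)).eq_or_lt with h0 | h0
  · rw [← h0]
    positivity
  · refine le_of_mul_le_mul_right ?_ h0
    calc (a ^ 2 + b ^ 2) * (a ^ 2 + b ^ 2)
        ≤ (‖f‖ * ‖WithLp.toLp 2 (a • x, b • y)‖) * (‖f‖ * ‖WithLp.toLp 2 (a • x, b • y)‖) :=
          mul_self_le_mul_self h0.le hf
      _ = ‖f‖ ^ 2 * ‖WithLp.toLp 2 (a • x, b • y)‖ ^ 2 := by ring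
      _ ≤ ‖f‖ ^ 2 * (a ^ 2 + b ^ 2) := mul_le_mul_of_nonneg_left hv (sq_nonneg _)

end DualRestrict

theorem isSNMap_symmPairing_dualRestrict (E : Type*) [NormedAddCommGroup E] [NormedSpace ℝ E] :
    IsSNMap
      (symmPairing (X := StrongDual ℝ E) (Z := StrongDual ℝ (WithLp 2 (E × StrongDual ℝ E)))
        (dualRestrictFst E (StrongDual ℝ E)) (dualRestrictSnd E (StrongDual ℝ E))) := by
  apply isSNMap_symmPairing
  intro f
  have hf := sq_norm_dualRestrict_le f
  exact hf

/-- Example 6.1. Let `E` be a nonzero real Banach space and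
`B := E × E*` with the norm `‖(x, x*)‖ = √(‖x‖² + ‖x*‖²)` (modelled by `WithLp 2 (E × E*)`).
There is a (necessarily unique) continuous linear map `L : B → B*` realizing
`L(x, x*) := (x*, x̂)` under the identification of `B*` with `E* × E**`, i.e. with
`⟨(y, y*), L(x, x*)⟩ = x*(y) + y*(x)`; `(B, L)` is a Banach SN space with
`q_L(x, x*) = ⟨x, x*⟩`, and there is a continuous linear map `L' : B* → B**` realizing
`L̃(y*, y**) := (y**, ŷ*)` (i.e. if `b* ≈ (y*, y**)` and `c* ≈ (z*, z**)` then
`⟨c*, L'b*⟩ = y**(z*) + z**(y*)`) which makes `(B*, L')` a Banach SN dual of `(B, L)`. -/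
theorem prod_withLp_two_banachSN (E : Type*) [NormedAddCommGroup E] [NormedSpace ℝ E]
    [CompleteSpace E] [Nontrivial E] :
    (∀ b : WithLp 2 (E × StrongDual ℝ E),
        ‖b‖ = Real.sqrt (‖(WithLp.equiv 2 (E × StrongDual ℝ E) b).1‖ ^ 2 +
          ‖(WithLp.equiv 2 (E × StrongDual ℝ E) b).2‖ ^ 2)) ∧
    ∃ L : WithLp 2 (E × StrongDual ℝ E) →L[ℝ] StrongDual ℝ (WithLp 2 (E × StrongDual ℝ E)),
      (∀ b c : WithLp 2 (E × StrongDual ℝ E),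
        L b c = (WithLp.equiv 2 (E × StrongDual ℝ E) b).2 (WithLp.equiv 2 (E × StrongDual ℝ E) c).1 +
          (WithLp.equiv 2 (E × StrongDual ℝ E) c).2 (WithLp.equiv 2 (E × StrongDual ℝ E) b).1) ∧
      IsSNMap L ∧
      (∀ b : WithLp 2 (E × StrongDual ℝ E),
        qL L b = (WithLp.equiv 2 (E × StrongDual ℝ E) b).2 (WithLp.equiv 2 (E × StrongDual ℝ E) b).1) ∧
      ∃ L' : StrongDual ℝ (WithLp 2 (E × StrongDual ℝ E)) →L[ℝ]
          StrongDual ℝ (StrongDual ℝ (WithLp 2 (E × StrongDual ℝ E))),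
        (∀ (b' c' : StrongDual ℝ (WithLp 2 (E × StrongDual ℝ E)))
            (y₁ z₁ : StrongDual ℝ E) (y₂ z₂ : StrongDual ℝ (StrongDual ℝ E)),
          (∀ p : E × StrongDual ℝ E, b' ((WithLp.equiv 2 (E × StrongDual ℝ E)).symm p) = y₁ p.1 + y₂ p.2) →
          (∀ p : E × StrongDual ℝ E, c' ((WithLp.equiv 2 (E × StrongDual ℝ E)).symm p) = z₁ p.1 + z₂ p.2) →
          L' b' c' = y₂ z₁ + z₂ y₁) ∧
        IsSNDual L L' := by
  have hL : ∀ b c : WithLp 2 (E × StrongDual ℝ E),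
      symmPairing (WithLp.fstL 2 ℝ E (StrongDual ℝ E)) (WithLp.sndL 2 ℝ E (StrongDual ℝ E)) b c =
        b.snd c.fst + c.snd b.fst := fun b c => symmPairing_apply _ _ b c
  refine ⟨fun b => WithLp.prod_norm_eq_of_L2 b, symmPairing _ _, hL,
    isSNMap_symmPairing _ _ fun b => (WithLp.prod_norm_sq_eq_of_L2 b).ge, fun b => ?_,
    symmPairing (X := StrongDual ℝ E) (Z := StrongDual ℝ (WithLp 2 (E × StrongDual ℝ E)))
      (dualRestrictFst E (StrongDual ℝ E)) (dualRestrictSnd E (StrongDual ℝ E)),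
    fun b' c' y₁ z₁ y₂ z₂ hb hc => ?_, isSNMap_symmPairing_dualRestrict E,
    fun b b' => ?_⟩
  · rw [qL, hL]
    change 1 / 2 * (b.snd b.fst + b.snd b.fst) = b.snd b.fst
    ring
  · have hb₁ : dualRestrictFst E (StrongDual ℝ E) b' = y₁ :=
      ContinuousLinearMap.ext fun x => (hb (x, 0)).trans (by simp)
    have hb₂ : dualRestrictSnd E (StrongDual ℝ E) b' = y₂ :=
      ContinuousLinearMap.ext fun x => (hb (0, x)).trans (by simp)
    have hc₁ : dualRestrictFst E (StrongDual ℝ E) c' = z₁ :=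
      ContinuousLinearMap.ext fun x => (hc (x, 0)).trans (by simp)
    have hc₂ : dualRestrictSnd E (StrongDual ℝ E) c' = z₂ :=
      ContinuousLinearMap.ext fun x => (hc (0, x)).trans (by simp)
    rw [symmPairing_apply, hb₁, hb₂, hc₁, hc₂]
  · have h₁ : dualRestrictFst E (StrongDual ℝ E) (symmPairing (WithLp.fstL 2 ℝ E (StrongDual ℝ E))
        (WithLp.sndL 2 ℝ E (StrongDual ℝ E)) b) = b.snd :=
      by
      ext x
      rw [dualRestrictFst_apply, hL]
      simp
    have h₂ : dualRestrictSnd E (StrongDual ℝ E) (symmPairing (WithLp.fstL 2 ℝ E (StrongDual ℝ E))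
        (WithLp.sndL 2 ℝ E (StrongDual ℝ E)) b) (dualRestrictFst E (StrongDual ℝ E) b') =
        dualRestrictFst E (StrongDual ℝ E) b' b.fst := by
      rw [dualRestrictSnd_apply, hL]
      simp
    rw [symmPairing_apply, h₁, h₂, add_comm]
    exact dualRestrictFst_add_dualRestrictSnd b' b.fst b.snd
end

section
/- Let E be a nonzero real Banach space, A be a closed linear monotone subspace of E × E*, and suppose that the adjoint subspace Aᵀ is a monotone subspace of E** × E*. Then A is maximally monotone in E × E* and Aᵀ is maximally monotone in E** × E*. -/
open NormedSpace

variable {E : Type*} [NormedAddCommGroup E] [NormedSpace ℝ E]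

/-- A subset `A` of `E × E*` is monotone: `A ≠ ∅` and
`⟨x - y, x* - y*⟩ ≥ 0` for all `(x, x*), (y, y*) ∈ A`. -/
def MonoSet (A : Set (E × StrongDual ℝ E)) : Prop :=
  A.Nonempty ∧ ∀ p ∈ A, ∀ q ∈ A, 0 ≤ (p.2 - q.2) (p.1 - q.1)

/-- `A` is a maximally monotone subset of `E × E*`. -/
def MaxMonoSet (A : Set (E × StrongDual ℝ E)) : Prop :=
  MonoSet A ∧ ∀ C : Set (E × StrongDual ℝ E), MonoSet C → A ⊆ C → C = A

/-- A subset `S` of `E** × E*` is monotone: `S ≠ ∅` and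
`⟨x* - y*, x** - y**⟩ ≥ 0` for all `(x**, x*), (y**, y*) ∈ S`. -/
def MonoSetBi (S : Set (StrongDual ℝ (StrongDual ℝ E) × StrongDual ℝ E)) : Prop :=
  S.Nonempty ∧ ∀ p ∈ S, ∀ q ∈ S, 0 ≤ (p.1 - q.1) (p.2 - q.2)

/-- `S` is a maximally monotone subset of `E** × E*`. -/
def MaxMonoSetBi (S : Set (StrongDual ℝ (StrongDual ℝ E) × StrongDual ℝ E)) : Prop :=
  MonoSetBi S ∧ ∀ C : Set (StrongDual ℝ (StrongDual ℝ E) × StrongDual ℝ E), MonoSetBi C → S ⊆ C → C = S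

/-- The adjoint subspace `Aᵀ ⊆ E** × E*` of a linear subspace `A ⊆ E × E*`:
`(y**, y*) ∈ Aᵀ ↔ ⟨a, y*⟩ = ⟨a*, y**⟩ for all (a, a*) ∈ A`. -/
def adjointSubspace (A : Set (E × StrongDual ℝ E)) : Set (StrongDual ℝ (StrongDual ℝ E) × StrongDual ℝ E) :=
  {p | ∀ a ∈ A, p.2 a.1 = p.1 a.2}

open Filter Topology

/-- **Ekeland's variational principle** for continuous functions. -/
theorem exists_forall_le_add_mul_dist {X : Type*} [MetricSpace X] [CompleteSpace X] [Nonempty X]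
    {f : X → ℝ} (hf : Continuous f) {m : ℝ} (hm : ∀ x, m ≤ f x) {ε : ℝ} (hε : 0 < ε) :
    ∃ z, ∀ y, f z ≤ f y + ε * dist z y := by
  let S : X → Set X := fun x => {y | f y + ε * dist x y ≤ f x}
  have hself : ∀ x, x ∈ S x := fun x => by simp [S]
  have htrans : ∀ {x y z}, y ∈ S x → z ∈ S y → z ∈ S x := by
    intro x y z hy hz
    simp only [S, Set.mem_ofPred_eq] at *
    nlinarith [dist_triangle x y z]
  have hclosed : ∀ x, IsClosed (S x) := fun x =>
    isClosed_le (by fun_prop) continuous_const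
  have hstep : ∀ (n : ℕ) (x : X), ∃ y ∈ S x, ∀ z ∈ S x, f y ≤ f z + (1 / 2 : ℝ) ^ n := by
    intro n x
    have hne : (f '' S x).Nonempty := ⟨f x, x, hself x, rfl⟩
    have hbdd : BddBelow (f '' S x) := ⟨m, by rintro _ ⟨y, -, rfl⟩; exact hm y⟩
    obtain ⟨_, ⟨y, hy, rfl⟩, hlt⟩ := Real.lt_sInf_add_pos hne (ε := (1 / 2 : ℝ) ^ n) (by positivity)
    refine ⟨y, hy, fun z hz => ?_⟩
    linarith [csInf_le hbdd ⟨z, hz, rfl⟩]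
  choose g hgS hg using hstep
  let x : ℕ → X := fun n => Nat.rec (Classical.arbitrary X) g n
  have hx : ∀ n, x (n + 1) = g n (x n) := fun n => rfl
  have hmem : ∀ n k, x (n + k) ∈ S (x n) := by
    intro n k
    induction k with
    | zero => exact hself _
    | succ k ih => exact htrans ih (hgS (n + k) (x (n + k)))
  have hdist : ∀ n, ∀ y ∈ S (x (n + 1)), dist (x (n + 1)) y ≤ (1 / 2 : ℝ) ^ n / ε := by
    intro n y hy
    have h := hg n (x n) y (htrans (hgS n (x n)) hy)
    rw [← hx] at h
    simp only [S, Set.mem_ofPred_eq] at hy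
    rw [le_div_iff₀ hε]
    linarith
  have hlim : Tendsto (fun n : ℕ => (1 / 2 : ℝ) ^ n / ε) atTop (𝓝 0) := by
    simpa using (tendsto_pow_atTop_nhds_zero_of_lt_one (r := (1 / 2 : ℝ)) (by norm_num)
      (by norm_num)).div_const ε
  have hcauchy : CauchySeq fun n => x (n + 1) := by
    refine cauchySeq_of_le_tendsto_0' _ (fun n k hnk => hdist n _ ?_) hlim
    obtain ⟨j, rfl⟩ := Nat.exists_eq_add_of_le hnk
    rw [Nat.add_right_comm]
    exact hmem _ _
  obtain ⟨z, hz⟩ := cauchySeq_tendsto_of_complete hcauchy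
  have hzS : ∀ n, z ∈ S (x (n + 1)) := by
    intro n
    refine (hclosed _).mem_of_tendsto hz (eventually_atTop.2 ⟨n, fun k hnk => ?_⟩)
    obtain ⟨j, rfl⟩ := Nat.exists_eq_add_of_le hnk
    rw [Nat.add_right_comm]
    exact hmem _ _
  refine ⟨z, fun y => ?_⟩
  by_contra! hlt
  have hy : y ∈ S z := hlt.le
  have hxy : Tendsto (fun n => x (n + 1)) atTop (𝓝 y) :=
    tendsto_iff_dist_tendsto_zero.2 (squeeze_zero (fun _ => dist_nonneg)
      (fun n => hdist n y (htrans (hzS n) hy)) hlim)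
  obtain rfl := tendsto_nhds_unique hz hxy
  simp at hlt

/-- A continuous convex function nonnegative on a subspace dominates a continuous linear functional
vanishing on that subspace. -/
theorem ConvexOn.exists_strongDual_le {X : Type*} [NormedAddCommGroup X] [NormedSpace ℝ X]
    {φ : X → ℝ} (hφ : ConvexOn ℝ Set.univ φ) (hcont : Continuous φ) (A : Submodule ℝ X)
    (hA : ∀ d ∈ A, 0 ≤ φ d) :
    ∃ F : StrongDual ℝ X, (∀ d ∈ A, F d = 0) ∧ ∀ d, F d ≤ φ d := by
  have hconv : Convex ℝ {p : X × ℝ | φ p.1 < p.2} := by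
    simpa using hφ.convex_strict_epigraph
  have hopen : IsOpen {p : X × ℝ | φ p.1 < p.2} :=
    isOpen_lt (by fun_prop) (by fun_prop)
  have hdisj : Disjoint {p : X × ℝ | φ p.1 < p.2} (A.prod (⊥ : Submodule ℝ ℝ) : Set (X × ℝ)) := by
    rw [Set.disjoint_left]
    rintro ⟨d, r⟩ hlt ⟨hd, hr⟩
    have hr : r = 0 := hr
    have hlt : φ d < r := hlt
    linarith [hA d hd]
  obtain ⟨f, u, hfs, hft⟩ :=
    geometric_hahn_banach_open hconv hopen (A.prod (⊥ : Submodule ℝ ℝ)).convex hdisj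
  have hu : u ≤ 0 := by simpa using hft 0 (Submodule.zero_mem _)
  have hzero : ∀ d ∈ A, f (d, 0) = 0 := by
    intro d hd
    by_contra hne
    have h := hft (((u - 1) / f (d, 0)) • (d, 0)) (Submodule.smul_mem _ _ ⟨hd, rfl⟩)
    rw [map_smul, smul_eq_mul, div_mul_cancel₀ _ hne] at h
    linarith
  have hsplit : ∀ d r, f (d, r) = f (d, 0) + r * f (0, 1) := by
    intro d r
    rw [← smul_eq_mul, ← map_smul, ← map_add]
    simp
  have hneg : f (0, 1) < 0 := by
    have h := hfs (0, |φ 0| + 1) (show φ 0 < |φ 0| + 1 by linarith [le_abs_self (φ 0)])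
    rw [hsplit, show ((0 : X), (0 : ℝ)) = 0 from rfl, map_zero] at h
    nlinarith [abs_nonneg (φ 0)]
  refine ⟨(-f (0, 1))⁻¹ • f.comp (.inl ℝ X ℝ), fun d hd => by simp [hzero d hd], fun d => ?_⟩
  refine le_of_forall_gt fun r hr => ?_
  have h := hfs (d, r) hr
  rw [hsplit] at h
  change (-f (0, 1))⁻¹ * f (d, 0) < r
  rw [inv_mul_lt_iff₀ (by linarith)]
  linarith

/-- Approximate first-order condition for minimizing the sum of a continuous convex function and a
continuous quadratic form over a complete subspace. -/
theorem exists_approx_stationary {X : Type*} [NormedAddCommGroup X] [NormedSpace ℝ X]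
    (A : Submodule ℝ X) [CompleteSpace A] {φ : X → ℝ} (hφ : ConvexOn ℝ Set.univ φ)
    (hcont : Continuous φ) (B : X →L[ℝ] X →L[ℝ] ℝ) {m : ℝ} (hm : ∀ b ∈ A, m ≤ φ b + B b b)
    {ε : ℝ} (hε : 0 < ε) :
    ∃ b ∈ A, ∃ F : StrongDual ℝ X, (∀ d ∈ A, F d = 0) ∧
      ∀ d, F d ≤ φ (b + d) - φ b + ε * ‖d‖ + (B b d + B d b) := by
  obtain ⟨⟨b, hb⟩, hmin⟩ := exists_forall_le_add_mul_dist (X := A) (f := fun b => φ b + B b b)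
    (by fun_prop) (fun b => hm b b.2) hε
  let ψ : X → ℝ := fun d => φ (b + d) - φ b + ε * ‖d‖ + (B b d + B d b)
  have hψ : ConvexOn ℝ Set.univ ψ := by
    have h1 : ConvexOn ℝ Set.univ fun d => φ (b + d) := by
      simpa [Function.comp_def] using hφ.translate_right b
    have h2 : ConvexOn ℝ Set.univ fun d : X => ε * ‖d‖ := (convexOn_univ_norm).smul hε.le
    have h3 : ConvexOn ℝ Set.univ fun d : X => B b d + B d b :=
      (B b + B.flip b).toLinearMap.convexOn convex_univ
    have h4 := ((h1.add_const (-φ b)).add h2).add h3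
    exact h4
  suffices hA : ∀ d ∈ A, 0 ≤ ψ d by
    obtain ⟨F, hF0, hF⟩ := hψ.exists_strongDual_le (by fun_prop) A hA
    exact ⟨b, hb, F, hF0, hF⟩
  intro d hd
  have hscaled : ∀ t : ℝ, 0 < t → t ≤ 1 → 0 ≤ ψ d + t * B d d := by
    intro t ht ht1
    have h := hmin ⟨b + t • d, A.add_mem hb (A.smul_mem t hd)⟩
    have hdist : dist (⟨b, hb⟩ : A) ⟨b + t • d, A.add_mem hb (A.smul_mem t hd)⟩ = t * ‖d‖ := by
      rw [Subtype.dist_eq, dist_self_add_right, norm_smul, Real.norm_of_nonneg ht.le]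
    have hc := hφ.2 (Set.mem_univ b) (Set.mem_univ (b + d)) (sub_nonneg.2 ht1) ht.le
      (sub_add_cancel 1 t)
    rw [show (1 - t) • b + t • (b + d) = b + t • d by module] at hc
    simp only [hdist, map_add, map_smul, add_apply,
      smul_apply, smul_eq_mul] at h hc
    refine nonneg_of_mul_nonneg_right (a := t) ?_ ht
    simp only [ψ]
    linarith
  have hlim : Tendsto (fun t : ℝ => ψ d + t * B d d) (𝓝[>] 0) (𝓝 (ψ d)) := by
    have : Tendsto (fun t : ℝ => ψ d + t * B d d) (𝓝 0) (𝓝 (ψ d + 0 * B d d)) :=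
      Continuous.tendsto (by fun_prop) 0
    simpa using this.mono_left nhdsWithin_le_nhds
  refine ge_of_tendsto hlim ?_
  filter_upwards [Ioc_mem_nhdsGT (zero_lt_one' ℝ)] with t ht using hscaled t ht.1 ht.2

/-- An approximate subgradient of `½‖·‖²` at `v` approximately belongs to the duality map at `v`. -/
theorem approx_duality_map {X : Type*} [NormedAddCommGroup X] [NormedSpace ℝ X]
    {v : X} {f : StrongDual ℝ X} {ε : ℝ} (hε : 0 < ε)
    (hf : ∀ d, f d ≤ ‖v + d‖ ^ 2 / 2 - ‖v‖ ^ 2 / 2 + ε * ‖d‖) :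
    ‖f‖ ≤ ‖v‖ + ε ∧ ‖v‖ ^ 2 - ε * ‖v‖ ≤ f v := by
  have key : ∀ d : X, ∀ c k : ℝ, (∀ t : ℝ, 0 < t → t ≤ 1 → t * f d ≤ t * (c + t * k)) →
      f d ≤ c := by
    intro d c k h
    have hlim : Tendsto (fun t : ℝ => c + t * k) (𝓝[>] 0) (𝓝 c) := by
      have : Tendsto (fun t : ℝ => c + t * k) (𝓝 0) (𝓝 (c + 0 * k)) :=
        Continuous.tendsto (by fun_prop) 0
      simpa using this.mono_left nhdsWithin_le_nhds
    refine ge_of_tendsto hlim ?_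
    filter_upwards [Ioc_mem_nhdsGT (zero_lt_one' ℝ)] with t ht
    exact le_of_mul_le_mul_left (h t ht.1 ht.2) ht.1
  constructor
  · have hle : ∀ d, f d ≤ (‖v‖ + ε) * ‖d‖ := by
      intro d
      refine key d _ (‖d‖ ^ 2 / 2) fun t ht _ => ?_
      have h := hf (t • d)
      have hn : ‖v + t • d‖ ≤ ‖v‖ + t * ‖d‖ := by
        simpa [norm_smul, abs_of_pos ht] using norm_add_le v (t • d)
      have hsq := pow_le_pow_left₀ (norm_nonneg _) hn 2
      rw [map_smul, smul_eq_mul, norm_smul, Real.norm_of_nonneg ht.le] at h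
      nlinarith
    refine f.opNorm_le_bound (by positivity) fun d => abs_le'.2 ⟨hle d, ?_⟩
    simpa using hle (-d)
  · have h : f (-v) ≤ -‖v‖ ^ 2 + ε * ‖v‖ := by
      refine key (-v) _ (‖v‖ ^ 2 / 2) fun t ht ht1 => ?_
      have h := hf (t • -v)
      rw [show v + t • -v = (1 - t) • v by module, map_smul, smul_eq_mul, norm_smul, norm_smul,
        norm_neg, Real.norm_of_nonneg ht.le, Real.norm_of_nonneg (sub_nonneg.2 ht1)] at h
      linarith
    rw [map_neg] at h
    linarith

/-- Approximate stationarity of `½‖a - c‖² + ½‖a* - c*‖² + ⟨a, a*⟩ + G (a, a*)` on a closed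
monotone subspace of `E × E*`. -/
theorem exists_approx_stationary_of_monotone [CompleteSpace E]
    (A : Submodule ℝ (E × StrongDual ℝ E)) (hAc : IsClosed (A : Set (E × StrongDual ℝ E)))
    (hpos : ∀ b ∈ A, 0 ≤ b.2 b.1) (c : E × StrongDual ℝ E) (G : StrongDual ℝ (E × StrongDual ℝ E))
    {ε : ℝ} (hε : 0 < ε) :
    ∃ b ∈ A, ∃ (f : StrongDual ℝ E) (g : StrongDual ℝ (StrongDual ℝ E)),
      (∀ d ∈ A, f d.1 + g d.2 + d.2 b.1 + b.2 d.1 + G d = 0) ∧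
      (‖f‖ ≤ ‖b.1 - c.1‖ + ε ∧ ‖b.1 - c.1‖ ^ 2 - ε * ‖b.1 - c.1‖ ≤ f (b.1 - c.1)) ∧
      (‖g‖ ≤ ‖b.2 - c.2‖ + ε ∧ ‖b.2 - c.2‖ ^ 2 - ε * ‖b.2 - c.2‖ ≤ g (b.2 - c.2)) := by
  have : CompleteSpace A := hAc.completeSpace_coe
  let φ : E × StrongDual ℝ E → ℝ := fun b =>
    ‖b.1 - c.1‖ ^ 2 / 2 + ‖b.2 - c.2‖ ^ 2 / 2 + G b
  let B : (E × StrongDual ℝ E) →L[ℝ] (E × StrongDual ℝ E) →L[ℝ] ℝ :=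
    ((ContinuousLinearMap.compL ℝ (E × StrongDual ℝ E) E ℝ).flip
      (.fst ℝ E (StrongDual ℝ E))).comp (.snd ℝ E (StrongDual ℝ E))
  have hB : ∀ p d, B p d = p.2 d.1 := fun p d => rfl
  have hsq : ∀ {X : Type _} [NormedAddCommGroup X] [NormedSpace ℝ X] (x : X),
      ConvexOn ℝ Set.univ fun y : X => ‖y - x‖ ^ 2 / 2 := by
    intro X _ _ x
    have h1 : ConvexOn ℝ Set.univ fun y : X => ‖y - x‖ := by
      simpa [Function.comp_def, sub_eq_add_neg] using
        (convexOn_univ_norm (E := X)).translate_left (-x)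
    have h2 := (h1.pow (fun _ _ => norm_nonneg _) 2).smul (c := (1 / 2 : ℝ)) (by norm_num)
    refine h2.congr fun y _ => ?_
    simp
    ring
  have hφ : ConvexOn ℝ Set.univ φ :=
    (((hsq c.1).comp_linearMap (LinearMap.fst ℝ E (StrongDual ℝ E))).add
      ((hsq c.2).comp_linearMap (LinearMap.snd ℝ E (StrongDual ℝ E)))).add
      (G.toLinearMap.convexOn convex_univ)
  have hm : ∀ b ∈ A, -‖G‖ ^ 2 - ‖G‖ * (‖c.1‖ + ‖c.2‖) ≤ φ b + B b b := by
    intro b hb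
    have h1 : -(‖G‖ * ‖b‖) ≤ G b := neg_le_of_abs_le (G.le_opNorm b)
    have h2 : ‖b‖ ≤ ‖b.1‖ + ‖b.2‖ :=
      max_le (by linarith [norm_nonneg b.2]) (by linarith [norm_nonneg b.1])
    have h3 : ‖b.1‖ ≤ ‖b.1 - c.1‖ + ‖c.1‖ := norm_le_norm_sub_add _ _
    have h4 : ‖b.2‖ ≤ ‖b.2 - c.2‖ + ‖c.2‖ := norm_le_norm_sub_add _ _
    have h5 := mul_le_mul_of_nonneg_left (show ‖b‖ ≤ ‖b.1 - c.1‖ + ‖c.1‖ + (‖b.2 - c.2‖ + ‖c.2‖)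
      by linarith) (norm_nonneg G)
    rw [hB]
    simp only [φ]
    nlinarith [hpos b hb, sq_nonneg (‖b.1 - c.1‖ - ‖G‖), sq_nonneg (‖b.2 - c.2‖ - ‖G‖)]
  obtain ⟨b, hb, F, hF0, hF⟩ := exists_approx_stationary A hφ (by fun_prop) B hm hε
  refine ⟨b, hb, (F - G).comp (.inl ℝ E (StrongDual ℝ E)) - b.2,
    (F - G).comp (.inr ℝ E (StrongDual ℝ E)) - inclusionInDoubleDual ℝ E b.1, fun d hd => ?_,
    approx_duality_map hε fun d => ?_, approx_duality_map hε fun d => ?_⟩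
  · have hsum : ∀ H : StrongDual ℝ (E × StrongDual ℝ E), H (d.1, 0) + H (0, d.2) = H d := by
      intro H
      rw [← map_add]
      simp
    have h1 := hsum F
    have h2 := hsum G
    rw [hF0 d hd] at h1
    simp
    linarith
  · have h := hF (d, 0)
    simp only [φ, hB, map_add, Prod.fst_add, Prod.snd_add, Prod.norm_mk, norm_zero, add_zero] at h
    rw [max_eq_left (norm_nonneg d), add_sub_right_comm b.1 d c.1] at h
    simp at h ⊢
    linarith
  · have h := hF (0, d)
    simp only [φ, hB, map_add, Prod.fst_add, Prod.snd_add, Prod.norm_mk, norm_zero, add_zero] at h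
    rw [max_eq_right (norm_nonneg d), add_sub_right_comm b.2 d c.2] at h
    simp at h ⊢
    linarith

theorem norm_add_norm_le_of_approx_duality {v : E} {w : StrongDual ℝ E} {f : StrongDual ℝ E}
    {g : StrongDual ℝ (StrongDual ℝ E)} {ε : ℝ} (hε : 0 < ε)
    (hf : ‖f‖ ≤ ‖v‖ + ε ∧ ‖v‖ ^ 2 - ε * ‖v‖ ≤ f v)
    (hg : ‖g‖ ≤ ‖w‖ + ε ∧ ‖w‖ ^ 2 - ε * ‖w‖ ≤ g w) (hwv : 0 ≤ w v)
    (h : (g + inclusionInDoubleDual ℝ E v) (f + w) ≤ 0) : ‖v‖ + ‖w‖ ≤ 10 * ε := by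
  have h1 : -(‖g‖ * ‖f‖) ≤ g f := neg_le_of_abs_le (g.le_opNorm f)
  have h2 : ‖g‖ * ‖f‖ ≤ (‖w‖ + ε) * (‖v‖ + ε) := by
    gcongr
    exacts [hg.1, hf.1]
  simp only [add_apply, map_add, dual_def] at h
  by_contra! hlt
  nlinarith [hf.2, hg.2, sq_nonneg (‖v‖ - ‖w‖)]

theorem IsClosed.mem_of_forall_exists_norm_sub_lt {X Y : Type*} [NormedAddCommGroup X]
    [NormedAddCommGroup Y] {S : Set (X × Y)} (hS : IsClosed S) {c : X × Y}
    (h : ∀ δ : ℝ, 0 < δ → ∃ p ∈ S, ‖p.1 - c.1‖ < δ ∧ ‖p.2 - c.2‖ < δ) : c ∈ S := by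
  refine hS.closure_subset (Metric.mem_closure_iff.2 fun δ hδ => ?_)
  obtain ⟨p, hp, h1, h2⟩ := h δ hδ
  refine ⟨p, hp, ?_⟩
  rw [dist_comm, dist_eq_norm]
  exact max_lt h1 h2

theorem mem_adjointSubspace_of_forall_exists_norm_sub_lt {A : Set (E × StrongDual ℝ E)}
    {c : StrongDual ℝ (StrongDual ℝ E) × StrongDual ℝ E}
    (h : ∀ δ : ℝ, 0 < δ → ∃ p ∈ adjointSubspace A, ‖p.1 - c.1‖ < δ ∧ ‖p.2 - c.2‖ < δ) :
    c ∈ adjointSubspace A := by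
  intro a ha
  have hle : ∀ δ : ℝ, 0 < δ → |c.2 a.1 - c.1 a.2| ≤ δ * (‖a.1‖ + ‖a.2‖) := by
    intro δ hδ
    obtain ⟨p, hp, h1, h2⟩ := h δ hδ
    have h3 : |p.1 a.2 - c.1 a.2| ≤ δ * ‖a.2‖ := (p.1 - c.1).le_of_opNorm_le h1.le a.2
    have h4 : |p.2 a.1 - c.2 a.1| ≤ δ * ‖a.1‖ := (p.2 - c.2).le_of_opNorm_le h2.le a.1
    have h5 := hp a ha
    rw [abs_le] at *
    constructor <;> linarith
  have hlim : Tendsto (fun δ : ℝ => δ * (‖a.1‖ + ‖a.2‖)) (𝓝[>] 0) (𝓝 0) := by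
    have : Tendsto (fun δ : ℝ => δ * (‖a.1‖ + ‖a.2‖)) (𝓝 0) (𝓝 (0 * (‖a.1‖ + ‖a.2‖))) :=
      Continuous.tendsto (by fun_prop) 0
    simpa using this.mono_left nhdsWithin_le_nhds
  have habs := ge_of_tendsto hlim (eventually_mem_nhdsWithin.mono hle)
  exact sub_eq_zero.1 (abs_nonpos_iff.1 habs)

/-- Theorem 6.4. Let `A` be a closed linear monotone subspace of `E × E*`
with `Aᵀ` monotone in `E** × E*`.  Then `A` and `Aᵀ` are maximally monotone in their
respective spaces. -/
theorem maxMono_and_adjoint_maxMono_of_adjoint_mono [CompleteSpace E] [Nontrivial E]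
    (A : Submodule ℝ (E × StrongDual ℝ E)) (hAc : IsClosed (A : Set (E × StrongDual ℝ E)))
    (hAmono : MonoSet (A : Set (E × StrongDual ℝ E)))
    (hadj : MonoSetBi (adjointSubspace (A : Set (E × StrongDual ℝ E)))) :
    MaxMonoSet (A : Set (E × StrongDual ℝ E)) ∧
      MaxMonoSetBi (adjointSubspace (A : Set (E × StrongDual ℝ E))) := by
  have hpos : ∀ b ∈ A, 0 ≤ b.2 b.1 := fun b hb => by
    simpa using hAmono.2 b hb 0 A.zero_mem
  have hzero : (0 : StrongDual ℝ (StrongDual ℝ E) × StrongDual ℝ E) ∈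
      adjointSubspace (A : Set (E × StrongDual ℝ E)) := fun a _ => by simp
  refine ⟨⟨hAmono, fun C hC hAC => (hAC.antisymm fun c hc => ?_).symm⟩,
    hadj, fun C hC hAC => (hAC.antisymm fun c hc => ?_).symm⟩
  · refine hAc.mem_of_forall_exists_norm_sub_lt fun δ hδ => ?_
    let G : StrongDual ℝ (E × StrongDual ℝ E) :=
      -(c.2.coprod (inclusionInDoubleDual ℝ E c.1))
    obtain ⟨b, hb, f, g, hfg, hf, hg⟩ :=
      exists_approx_stationary_of_monotone A hAc hpos c G (ε := δ / 20) (by positivity)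
    have hmem : (-(g + inclusionInDoubleDual ℝ E (b.1 - c.1)), f + (b.2 - c.2)) ∈
        adjointSubspace (A : Set (E × StrongDual ℝ E)) := by
      intro d hd
      have h := hfg d hd
      simp [G] at h ⊢
      linarith
    have hle : (g + inclusionInDoubleDual ℝ E (b.1 - c.1)) (f + (b.2 - c.2)) ≤ 0 := by
      have h := hadj.2 _ hmem 0 hzero
      simp only [Prod.fst_zero, Prod.snd_zero, sub_zero] at h
      change 0 ≤ -((g + inclusionInDoubleDual ℝ E (b.1 - c.1)) (f + (b.2 - c.2))) - 0 at h
      linarith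
    have hsmall := norm_add_norm_le_of_approx_duality (by positivity) hf hg
      (hC.2 b (hAC hb) c hc) hle
    exact ⟨b, hb, by linarith [norm_nonneg (b.2 - c.2)], by linarith [norm_nonneg (b.1 - c.1)]⟩
  · refine mem_adjointSubspace_of_forall_exists_norm_sub_lt fun δ hδ => ?_
    let G : StrongDual ℝ (E × StrongDual ℝ E) := (-c.2).coprod c.1
    obtain ⟨b, hb, f, g, hfg, hf, hg⟩ :=
      exists_approx_stationary_of_monotone A hAc hpos 0 G (ε := δ / 20) (by positivity)
    simp only [Prod.fst_zero, Prod.snd_zero, sub_zero] at hf hg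
    have hmem : (c.1 + (g + inclusionInDoubleDual ℝ E b.1), c.2 - (f + b.2)) ∈
        adjointSubspace (A : Set (E × StrongDual ℝ E)) := by
      intro d hd
      have h := hfg d hd
      simp [G] at h ⊢
      linarith
    have hle : (g + inclusionInDoubleDual ℝ E b.1) (f + b.2) ≤ 0 := by
      have h := hC.2 _ (hAC hmem) c hc
      simp only [sub_sub_cancel_left, map_neg] at h
      change 0 ≤ -(c.1 (f + b.2) + (g + inclusionInDoubleDual ℝ E b.1) (f + b.2) -
        c.1 (f + b.2)) at h
      linarith
    have hsmall := norm_add_norm_le_of_approx_duality (by positivity) hf hg (hpos b hb) hle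
    have h1 : ‖g + inclusionInDoubleDual ℝ E b.1‖ ≤ ‖g‖ + ‖b.1‖ :=
      (ContinuousLinearMap.opNorm_add_le _ _).trans
        (add_le_add_right (double_dual_bound ℝ E b.1) _)
    have h2 : ‖f + b.2‖ ≤ ‖f‖ + ‖b.2‖ := norm_add_le _ _
    have h3 : c.1 + (g + inclusionInDoubleDual ℝ E b.1) - c.1 =
        g + inclusionInDoubleDual ℝ E b.1 :=
      ContinuousLinearMap.ext fun z => add_sub_cancel_left (c.1 z) _
    refine ⟨_, hmem, ?_, ?_⟩
    · rw [h3]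
      linarith [hg.1]
    · rw [sub_sub_cancel_left, norm_neg]
      linarith [hf.1]
end
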